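/- arXiv:1409.8223 — 5 statements merged into one kernel-verified Lean document; each statement's English description precedes it below -/
import Mathlib

section
/- Let n ≥ 2 and k ≥ 1 be integers. Let p, q be real polynomials in n variables with q ≠ 0 as a polynomial and with finite zero set Z(q) = {x ∈ ℝ^n : q(x) = 0}, and let g be the rational function g(x) = p(x)/q(x) defined on the open set U = {x ∈ ℝ^n : q(x) ≠ 0}. Assume that the map x ↦ iteratedFDeriv ℝ k g x, defined on U, admits a continuous extension to all of ℝ^n (i.e., all k-th order partial derivatives of g extend continuously to ℝ^n). Then there exists a function F : ℝ^n → ℝ of class C^k on ℝ^n such that F(x) = g(x) for every x ∈ U; in particular F is k-regulous. -/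
open MvPolynomial

open scoped Classical in
open Set Filter Topology in
/-- mean value inequality on a punctured ball in dimension at least two -/
theorem punctured_mvt {E F : Type*} [NormedAddCommGroup E] [NormedSpace ℝ E]
    [NormedAddCommGroup F] [NormedSpace ℝ F] (hE : 1 < Module.rank ℝ E)
    (f : E → F) (f' : E → E →L[ℝ] F) (s : E) (r C : ℝ)
    (hf : ∀ x ∈ Metric.ball s r, x ≠ s → HasFDerivAt f (f' x) x)
    (hC : ∀ x ∈ Metric.ball s r, x ≠ s → ‖f' x‖ ≤ C)
    (x y : E) (hx : x ∈ Metric.ball s r) (hy : y ∈ Metric.ball s r) (hxs : x ≠ s) (hys : y ≠ s) :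
    ‖f y - f x‖ ≤ C * ‖y - x‖ := by
  have key : ∀ z ∈ Metric.ball s r, s ∉ segment ℝ x z → ‖f z - f x‖ ≤ C * ‖z - x‖ := by
    intro z hz hs
    have hsub : segment ℝ x z ⊆ Metric.ball s r := (convex_ball s r).segment_subset hx hz
    refine (convex_segment x z).norm_image_sub_le_of_norm_hasFDerivWithin_le (f' := f')
      (fun w hw => ?_) (fun w hw => ?_) (left_mem_segment ℝ x z) (right_mem_segment ℝ x z)
    · exact (hf w (hsub hw) (fun h => hs (h ▸ hw))).hasFDerivWithinAt
    · exact hC w (hsub hw) (fun h => hs (h ▸ hw))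
  by_cases hs : s ∈ segment ℝ x y
  swap
  · exact key y hy hs
  have hyx : y - x ≠ 0 := by
    intro h
    have : y = x := sub_eq_zero.1 h
    subst this
    simp at hs
    exact hys hs.symm
  obtain ⟨v, hv⟩ := exists_linearIndependent_pair_of_one_lt_rank hE hyx
  rw [LinearIndependent.pair_iff] at hv
  have hcont : ContinuousAt (fun t : ℝ => y + t • v) 0 := by fun_prop
  have ht0 : Tendsto (fun t : ℝ => y + t • v) (𝓝[≠] 0) (𝓝 y) := by
    have := hcont.tendsto
    simp only [zero_smul, add_zero] at this
    exact this.mono_left nhdsWithin_le_nhds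
  have h1 : ∀ᶠ t in 𝓝[≠] (0 : ℝ), ‖f (y + t • v) - f x‖ ≤ C * ‖y + t • v - x‖ := by
    filter_upwards [ht0.eventually (Metric.isOpen_ball.mem_nhds hy), self_mem_nhdsWithin]
      with t ht htn
    refine key _ ht fun hmem => ?_
    rw [segment_eq_image'] at hs hmem
    obtain ⟨a, -, ha⟩ := hs
    obtain ⟨b, -, hb⟩ := hmem
    simp only at ha hb
    have hb0 : b ≠ 0 := by
      rintro rfl
      simp at hb
      exact hxs hb
    have h3 : (b - a) • (y - x) + (b * t) • v = 0 := by
      have : b • (y + t • v - x) = a • (y - x) := by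
        have h4 := hb.trans ha.symm
        exact add_left_cancel h4
      have h5 : (b - a) • (y - x) + (b * t) • v = b • (y + t • v - x) - a • (y - x) := by
        module
      rw [h5, this, sub_self]
    exact (mul_ne_zero hb0 htn) (hv _ _ h3).2
  have hfy : Tendsto (fun t : ℝ => f (y + t • v)) (𝓝[≠] 0) (𝓝 (f y)) :=
    (hf y hy hys).continuousAt.tendsto.comp ht0
  exact le_of_tendsto_of_tendsto (hfy.sub_const _).norm ((ht0.sub_const x).norm.const_mul C) h1

open scoped Classical in
open Set Filter Topology in
theorem punctured_ext {E F : Type*} [NormedAddCommGroup E] [NormedSpace ℝ E]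
    [NormedAddCommGroup F] [NormedSpace ℝ F] [CompleteSpace F] (hE : 1 < Module.rank ℝ E)
    (f : E → F) (G : E → E →L[ℝ] F) (s : E) (hG : ContinuousAt G s)
    (hf : ∀ᶠ x in 𝓝[≠] s, HasFDerivAt f (G x) x) :
    ∃ l, Tendsto f (𝓝[≠] s) (𝓝 l) ∧ HasFDerivAt (Function.update f s l) (G s) s := by
  have : Nontrivial E := by
    have := (rank_pos_iff_nontrivial (R := ℝ) (M := E)).1 (lt_trans zero_lt_one hE)
    exact this
  have : (𝓝[≠] s).NeBot := Module.punctured_nhds_neBot ℝ E s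
  have key : ∀ ε > 0, ∃ r > 0, ∀ x ∈ Metric.ball s r, ∀ y ∈ Metric.ball s r, x ≠ s → y ≠ s →
      ‖(f y - G s y) - (f x - G s x)‖ ≤ ε * ‖y - x‖ := by
    intro ε hε
    have h1 : ∀ᶠ x in 𝓝 s, ‖G x - G s‖ < ε := by
      have := Metric.continuousAt_iff'.1 hG ε hε
      simpa [dist_eq_norm] using this
    rw [eventually_nhdsWithin_iff] at hf
    obtain ⟨r, hr, h⟩ := Metric.eventually_nhds_iff_ball.1 (h1.and hf)
    refine ⟨r, hr, fun x hx y hy hxs hys => ?_⟩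
    exact punctured_mvt hE (fun z => f z - G s z) (fun z => G z - G s) s r ε
      (fun z hz hzs => ((h z hz).2 hzs).sub (G s).hasFDerivAt) (fun z hz _ => (h z hz).1.le)
      x y hx hy hxs hys
  obtain ⟨m, hm⟩ : ∃ m, Tendsto (fun x => f x - G s x) (𝓝[≠] s) (𝓝 m) := by
    rw [← cauchy_map_iff_exists_tendsto]
    rw [Metric.cauchy_iff]
    refine ⟨inferInstance, fun ε hε => ?_⟩
    obtain ⟨r, hr, h⟩ := key 1 one_pos
    refine ⟨_, image_mem_map (inter_mem_nhdsWithin _ (Metric.ball_mem_nhds s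
      (lt_min hr (half_pos hε)))), ?_⟩
    rintro _ ⟨x, ⟨hxs, hx⟩, rfl⟩ _ ⟨y, ⟨hys, hy⟩, rfl⟩
    rw [dist_comm, dist_eq_norm]
    have hx' := Metric.ball_subset_ball (min_le_left _ _) hx
    have hy' := Metric.ball_subset_ball (min_le_left _ _) hy
    have hx2 := Metric.ball_subset_ball (min_le_right _ _) hx
    have hy2 := Metric.ball_subset_ball (min_le_right _ _) hy
    refine (h x hx' y hy' hxs hys).trans_lt ?_
    rw [one_mul, ← dist_eq_norm]
    have := dist_triangle_right y x s
    rw [Metric.mem_ball] at hx2 hy2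
    linarith
  have hGs : Tendsto (fun x => G s x) (𝓝[≠] s) (𝓝 (G s s)) :=
    (G s).continuous.continuousAt.tendsto.mono_left nhdsWithin_le_nhds
  have hl : Tendsto f (𝓝[≠] s) (𝓝 (m + G s s)) := by
    simpa using hm.add hGs
  refine ⟨m + G s s, hl, ?_⟩
  rw [hasFDerivAt_iff_isLittleO, Asymptotics.isLittleO_iff]
  intro ε hε
  obtain ⟨r, hr, h⟩ := key ε hε
  filter_upwards [Metric.ball_mem_nhds s hr] with y hy
  by_cases hys : y = s
  · subst hys; simp
  rw [Function.update_of_ne hys, Function.update_self]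
  have h1 : ∀ᶠ x in 𝓝[≠] s, ‖(f y - G s y) - (f x - G s x)‖ ≤ ε * ‖y - x‖ := by
    filter_upwards [self_mem_nhdsWithin, nhdsWithin_le_nhds (Metric.ball_mem_nhds s hr)]
      with x hxs hx
    exact h x hx y hy hxs hys
  have hid : Tendsto (fun x : E => x) (𝓝[≠] s) (𝓝 s) := tendsto_id.mono_left nhdsWithin_le_nhds
  have h2 := le_of_tendsto_of_tendsto (hm.const_sub (f y - G s y)).norm
    ((hid.const_sub y).norm.const_mul ε) h1
  have h3 : f y - (m + G s s) - G s (y - s) = f y - G s y - m := by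
    rw [map_sub]; abel
  rw [h3]; exact h2

open scoped Classical in
open Set Filter Topology in
theorem finite_ext {E F : Type*} [NormedAddCommGroup E] [NormedSpace ℝ E]
    [NormedAddCommGroup F] [NormedSpace ℝ F] [CompleteSpace F] (hE : 1 < Module.rank ℝ E)
    (f : E → F) (G : E → E →L[ℝ] F) (S : Set E) (hS : S.Finite) (hG : Continuous G)
    (hf : ∀ x ∉ S, HasFDerivAt f (G x) x) :
    ∃ H : E → F, (∀ x, HasFDerivAt H (G x) x) ∧ ∀ x ∉ S, H x = f x := by
  have hev : ∀ s, ∀ᶠ x in 𝓝[≠] s, x ∉ S := by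
    intro s
    rw [eventually_nhdsWithin_iff]
    filter_upwards [(hS.subset (sdiff_subset (t := {s}))).isClosed.isOpen_compl.mem_nhds
      (show s ∈ (S \ {s})ᶜ by simp)] with x hx hxs hxS
    exact hx ⟨hxS, hxs⟩
  have : Nontrivial E := (rank_pos_iff_nontrivial (R := ℝ) (M := E)).1 (lt_trans zero_lt_one hE)
  choose H hH hH' using fun s => punctured_ext hE f G s hG.continuousAt ((hev s).mono hf)
  have heq : ∀ x ∉ S, H x = f x := by
    intro x hx
    have : (𝓝[≠] x).NeBot := Module.punctured_nhds_neBot ℝ E x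
    exact tendsto_nhds_unique (hH x)
      ((hf x hx).continuousAt.tendsto.mono_left nhdsWithin_le_nhds)
  refine ⟨H, fun x => ?_, heq⟩
  refine (hH' x).congr_of_eventuallyEq ?_
  filter_upwards [eventually_nhdsWithin_iff.1 (hev x)] with y hy
  by_cases hyx : y = x
  · subst hyx; simp
  · rw [Function.update_of_ne hyx]
    exact heq y (hy hyx)

open scoped Classical in
open Set Filter Topology in
theorem finite_ext_Ck {E F : Type*} [NormedAddCommGroup E] [NormedSpace ℝ E]
    [NormedAddCommGroup F] [NormedSpace ℝ F] [CompleteSpace F] (hE : 1 < Module.rank ℝ E)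
    (f : E → F) (S : Set E) (hS : S.Finite) (k : ℕ)
    (hf : ∀ x ∉ S, ContDiffAt ℝ k f x)
    (G : E → ContinuousMultilinearMap ℝ (fun _ : Fin k => E) F) (hG : Continuous G)
    (hGf : ∀ x ∉ S, G x = iteratedFDeriv ℝ k f x) :
    ∃ H : E → F, ContDiff ℝ k H ∧ (∀ x ∉ S, H x = f x) := by
  induction k with
  | zero =>
    refine ⟨fun x => G x 0, ?_, fun x hx => ?_⟩
    · rw [Nat.cast_zero, contDiff_zero]
      fun_prop
    · change G x 0 = f x
      rw [hGf x hx, iteratedFDeriv_zero_apply]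
  | succ k ih =>
    have : Nontrivial E := (rank_pos_iff_nontrivial (R := ℝ) (M := E)).1 (lt_trans zero_lt_one hE)
    have hG' : Continuous (fun x => continuousMultilinearCurryLeftEquiv ℝ (fun _ : Fin (k+1) => E) F (G x)) :=
      (LinearIsometryEquiv.continuous _).comp hG
    have hder : ∀ x ∉ S, HasFDerivAt (iteratedFDeriv ℝ k f)
        (continuousMultilinearCurryLeftEquiv ℝ (fun _ : Fin (k+1) => E) F (G x)) x := by
      intro x hx
      have hd : DifferentiableAt ℝ (iteratedFDeriv ℝ k f) x :=
        (hf x hx).differentiableAt_iteratedFDeriv (by exact_mod_cast Nat.lt_succ_self k)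
      have := hd.hasFDerivAt
      rw [fderiv_iteratedFDeriv] at this
      rw [hGf x hx]
      exact this
    obtain ⟨K, hK, hKf⟩ := finite_ext hE _ _ S hS hG' hder
    have hKc : Continuous K := continuous_iff_continuousAt.2 fun x => (hK x).continuousAt
    obtain ⟨H, hH, hHf⟩ := ih (fun x hx => (hf x hx).of_le (by exact_mod_cast Nat.le_succ k))
      K hKc hKf
    refine ⟨H, ?_, hHf⟩
    have hHK : iteratedFDeriv ℝ k H = K := by
      refine Continuous.ext_on (hS.countable.dense_compl ℝ)
        (hH.continuous_iteratedFDeriv le_rfl) hKc fun x hx => ?_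
      rw [hKf x hx]
      refine Filter.EventuallyEq.eq_of_nhds (Filter.EventuallyEq.iteratedFDeriv (𝕜 := ℝ) ?_ k)
      filter_upwards [hS.isClosed.isOpen_compl.mem_nhds hx] with y hy using hHf y hy
    have hlast : iteratedFDeriv ℝ (k+1) H = G := by
      funext x
      have h1 := (hK x).fderiv
      rw [← hHK, fderiv_iteratedFDeriv] at h1
      exact (continuousMultilinearCurryLeftEquiv ℝ (fun _ : Fin (k+1) => E) F).injective h1
    rw [contDiff_nat_iff_continuous_differentiable] at hH ⊢
    refine ⟨fun m hm => ?_, fun m hm => ?_⟩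
    · rcases Nat.lt_or_ge k m with h | h
      · obtain rfl : m = k + 1 := by omega
        rw [hlast]; exact hG
      · exact hH.1 m h
    · rcases Nat.lt_or_ge m k with h | h
      · exact hH.2 m h
      · obtain rfl : m = k := by omega
        rw [hHK]; exact fun x => (hK x).differentiableAt

/-- if all k-th partial derivatives of the rational function `p/q`
(with `Z(q)` finite, codimension ≥ 2 in `ℝ^n`, `n ≥ 2`) extend continuously to `ℝ^n`,
then `p/q` extends to a `C^k` function on `ℝ^n`. -/
theorem rational_with_continuous_kth_derivs_extends_Ck
    (n k : ℕ) (hn : 2 ≤ n) (hk : 1 ≤ k)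
    (p q : MvPolynomial (Fin n) ℝ) (hq : q ≠ 0)
    (hfin : {x : Fin n → ℝ | eval x q = 0}.Finite)
    (g : (Fin n → ℝ) → ℝ)
    (hg : g = fun x => eval x p / eval x q)
    (hext : ∃ G : (Fin n → ℝ) → ContinuousMultilinearMap ℝ (fun _ : Fin k => Fin n → ℝ) ℝ,
      Continuous G ∧ ∀ x : Fin n → ℝ, eval x q ≠ 0 → G x = iteratedFDeriv ℝ k g x) :
    ∃ F : (Fin n → ℝ) → ℝ, ContDiff ℝ k F ∧ ∀ x : Fin n → ℝ, eval x q ≠ 0 → F x = g x := by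
  obtain ⟨G, hG, hGg⟩ := hext
  have hpoly : ∀ r : MvPolynomial (Fin n) ℝ, ContDiff ℝ k (fun x : Fin n → ℝ => eval x r) := by
    intro r
    induction r using MvPolynomial.induction_on with
    | C a => simpa using contDiff_const
    | add a b ha hb => simpa using ha.add hb
    | mul_X a i ha => simpa using ha.mul (contDiff_apply ℝ ℝ i)
  refine finite_ext_Ck ?_ g _ hfin k (fun x hx => ?_) G hG hGg
  · rw [rank_fun']
    simp only [Fintype.card_fin]
    exact_mod_cast hn
  · rw [hg]
    exact (hpoly p).contDiffAt.div (hpoly q).contDiffAt hx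
end

section
/- Let f : ℝ² → ℝ be continuous and let p, q ∈ ℝ[x,y] be relatively prime polynomials (every common divisor of p and q is a unit) with q ≠ 0, q(x) ≥ 0 for all x ∈ ℝ², finite zero set Z(q) = q⁻¹(0), and f(x) = p(x)/q(x) for every x with q(x) ≠ 0. Then the following are equivalent: (i) for every a ∈ Z(q), the lowest-degree nonzero homogeneous component of the polynomial y ↦ q(a + y) is positive definite, i.e., takes positive values at every y ≠ 0; (ii) for every a = (a₁,a₂) ∈ Z(q), f becomes regular after blowing up the point a, meaning: there exist polynomials r₁, s₁, r₂, s₂ ∈ ℝ[u,v] such that s₁(0,v) ≠ 0 for all v ∈ ℝ, s₂(u,0) ≠ 0 for all u ∈ ℝ, f(a₁ + u, a₂ + u·v) = r₁(u,v)/s₁(u,v) for all (u,v) with s₁(u,v) ≠ 0, and f(a₁ + u·v, a₂ + v) = r₂(u,v)/s₂(u,v) for all (u,v) with s₂(u,v) ≠ 0. -/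
open MvPolynomial

/-- The polynomial `y ↦ q(a + y)`. -/
noncomputable def shiftPoly (a : Fin 2 → ℝ) (q : MvPolynomial (Fin 2) ℝ) :
    MvPolynomial (Fin 2) ℝ :=
  bind₁ (fun i => C (a i) + X i) q

/-- The lowest-degree nonzero homogeneous component of `y ↦ q(a + y)` is positive
definite: it takes positive values at every `y ≠ 0`. -/
def LocPosDef (q : MvPolynomial (Fin 2) ℝ) (a : Fin 2 → ℝ) : Prop :=
  ∃ m : ℕ, homogeneousComponent m (shiftPoly a q) ≠ 0 ∧
    (∀ d < m, homogeneousComponent d (shiftPoly a q) = 0) ∧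
    ∀ y : Fin 2 → ℝ, y ≠ 0 → 0 < eval y (homogeneousComponent m (shiftPoly a q))

/-- `p, q` is a representation of `f` witnessing that `f` is [1]-regulous:
`p` and `q` are relatively prime, `q ≥ 0` on `ℝ²` with finite zero set, `f = p/q` off
`Z(q)`, and at every point of `Z(q)` the lowest-degree homogeneous component of `q` is
positive definite. -/
def OneRegulousRep (f : (Fin 2 → ℝ) → ℝ) (p q : MvPolynomial (Fin 2) ℝ) : Prop :=
  IsRelPrime p q ∧ (∀ x : Fin 2 → ℝ, 0 ≤ eval x q) ∧
    {x : Fin 2 → ℝ | eval x q = 0}.Finite ∧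
    (∀ x : Fin 2 → ℝ, eval x q ≠ 0 → f x = eval x p / eval x q) ∧
    ∀ a : Fin 2 → ℝ, eval a q = 0 → LocPosDef q a

/-- `f : ℝ² → ℝ` is [1]-regulous: continuous, and a rational function which becomes
regular after one stage of blowings-up of points. -/
def OneRegulous (f : (Fin 2 → ℝ) → ℝ) : Prop :=
  Continuous f ∧ ∃ p q : MvPolynomial (Fin 2) ℝ, OneRegulousRep f p q

namespace BlowAux

theorem vec_eta (x : Fin 2 → ℝ) : x = ![x 0, x 1] := by
  ext i; fin_cases i <;> rfl

theorem eval_hom {h : MvPolynomial (Fin 2) ℝ} {d : ℕ} (hh : h.IsHomogeneous d) (u v : ℝ) :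
    eval ![u, u * v] h = u ^ d * eval ![1, v] h := by
  rw [eval_eq', eval_eq', Finset.mul_sum]
  refine Finset.sum_congr rfl fun e he => ?_
  have h1 := hh (mem_support_iff.mp he)
  have h2 : e 0 + e 1 = d := by
    rw [← h1, Finsupp.weight_apply, Finsupp.sum_fintype _ _ (by simp)]
    simp [Fin.sum_univ_two]
  simp only [Fin.prod_univ_two, Matrix.cons_val_zero, Matrix.cons_val_one, ← h2]
  ring

theorem hom_eq_zero {h : MvPolynomial (Fin 2) ℝ} {d : ℕ} (hh : h.IsHomogeneous d)
    (h0 : ∀ v : ℝ, eval ![1, v] h = 0) : h = 0 := by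
  have : X 0 * h = 0 := by
    apply MvPolynomial.funext
    intro x
    rw [map_mul, eval_X, map_zero]
    by_cases hx : x 0 = 0
    · simp [hx]
    · have h1 := eval_hom hh (x 0) (x 1 / x 0)
      rw [mul_div_cancel₀ _ hx, ← vec_eta, h0] at h1
      rw [h1]; simp
  exact (mul_eq_zero.mp this).resolve_left (X_ne_zero 0)

theorem blow (Q : MvPolynomial (Fin 2) ℝ) (m : ℕ)
    (hm : ∀ d < m, homogeneousComponent d Q = 0) :
    ∃ s : MvPolynomial (Fin 2) ℝ,
      (∀ u v : ℝ, eval ![u, u * v] Q = u ^ m * eval ![u, v] s) ∧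
      ∀ v : ℝ, eval ![0, v] s = eval ![1, v] (homogeneousComponent m Q) := by
  refine ⟨∑ d ∈ Finset.range (Q.totalDegree + m + 1),
    if d < m then 0 else X 0 ^ (d - m) * bind₁ ![1, X 1] (homogeneousComponent d Q), ?_, ?_⟩
  · intro u v
    have hQ : Q = ∑ d ∈ Finset.range (Q.totalDegree + m + 1), homogeneousComponent d Q := by
      conv_lhs => rw [← sum_homogeneousComponent Q]
      apply Finset.sum_subset
      · intro i; simp only [Finset.mem_range]; omega
      · intro i _ hi
        apply homogeneousComponent_eq_zero
        simp only [Finset.mem_range] at hi; omega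
    conv_lhs => rw [hQ]
    rw [map_sum, map_sum, Finset.mul_sum]
    refine Finset.sum_congr rfl fun d _ => ?_
    split_ifs with h
    · simp [hm d h]
    · rw [eval_hom (homogeneousComponent_isHomogeneous d Q), map_mul, map_pow, eval_X,
        ← mul_assoc]
      have e1 : eval ![u, v] (bind₁ ![1, X 1] (homogeneousComponent d Q))
          = eval ![1, v] (homogeneousComponent d Q) := by
        rw [← coe_aeval_eq_eval, RingHom.coe_coe, aeval_bind₁, ← coe_aeval_eq_eval, RingHom.coe_coe]
        congr 2
        ext i; fin_cases i <;> simp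
      rw [e1, Matrix.cons_val_zero, ← pow_add]
      congr 2; omega
  · intro v
    rw [map_sum, Finset.sum_eq_single m]
    · simp only [lt_irrefl, if_false, Nat.sub_self, pow_zero, one_mul]
      rw [← coe_aeval_eq_eval, RingHom.coe_coe, aeval_bind₁, ← coe_aeval_eq_eval, RingHom.coe_coe]
      congr 2
      ext i; fin_cases i <;> simp
    · intro d _ hd
      split_ifs with h
      · simp
      · have : d - m ≠ 0 := by omega
        simp [this]
    · intro h; simp only [Finset.mem_range] at h; omega

theorem unblow (s : MvPolynomial (Fin 2) ℝ) :
    ∃ N0 : ℕ, ∀ N ≥ N0, ∃ S : MvPolynomial (Fin 2) ℝ,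
      ∀ u v : ℝ, eval ![u, u * v] S = u ^ N * eval ![u, v] s := by
  induction s using MvPolynomial.induction_on with
  | C a => exact ⟨0, fun N _ => ⟨X 0 ^ N * C a, by simp⟩⟩
  | add p q hp hq =>
    obtain ⟨n1, h1⟩ := hp
    obtain ⟨n2, h2⟩ := hq
    refine ⟨n1 + n2, fun N hN => ?_⟩
    obtain ⟨S, hS⟩ := h1 N (by omega)
    obtain ⟨T, hT⟩ := h2 N (by omega)
    exact ⟨S + T, fun u v => by rw [map_add, map_add, hS, hT]; ring⟩
  | mul_X p i hp =>
    obtain ⟨n, h⟩ := hp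
    refine ⟨n + 1, fun N hN => ?_⟩
    obtain ⟨k, rfl⟩ : ∃ k, N = k + 1 := ⟨N - 1, by omega⟩
    fin_cases i
    · obtain ⟨S, hS⟩ := h (k + 1) (by omega)
      exact ⟨S * X 0, fun u v => by simp [hS]; ring⟩
    · obtain ⟨S, hS⟩ := h k (by omega)
      exact ⟨S * X 1, fun u v => by simp [hS]; ring⟩

theorem cont_eval (s : MvPolynomial (Fin 2) ℝ) (v : ℝ) :
    Continuous fun u : ℝ => eval ![u, v] s := by
  have := MvPolynomial.continuous_eval s
  exact this.comp (by fun_prop)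

theorem eq_of_ne {F G : ℝ → ℝ} (hF : Continuous F) (hG : Continuous G)
    (h : ∀ u, u ≠ 0 → F u = G u) : F = G :=
  Continuous.ext_on (dense_compl_singleton (0 : ℝ)) hF hG (fun u hu => h u hu)

theorem order_le {g : (Fin 2 → ℝ) → ℝ} (hg : Continuous g) {P Q : MvPolynomial (Fin 2) ℝ}
    (hPQ : ∀ x, eval x P = g x * eval x Q) {m : ℕ}
    (hm : ∀ d < m, homogeneousComponent d Q = 0) :
    ∀ d < m, homogeneousComponent d P = 0 := by
  intro k
  induction k using Nat.strong_induction_on with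
  | _ k ih =>
    intro hk
    obtain ⟨ρ, hρ, hρ0⟩ := blow P k (fun d hd => ih d hd (hd.trans hk))
    obtain ⟨σ, hσ, -⟩ := blow Q m hm
    apply hom_eq_zero (homogeneousComponent_isHomogeneous k P)
    intro v
    rw [← hρ0]
    have := eq_of_ne (F := fun u => eval ![u, v] ρ)
      (G := fun u => g ![u, u * v] * (u ^ (m - k) * eval ![u, v] σ)) (cont_eval ρ v)
      ((hg.comp (by fun_prop)).mul ((continuous_id.pow _).mul (cont_eval σ v))) (by
        intro u hu
        have h1 := hPQ ![u, u * v]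
        rw [hρ, hσ] at h1
        have h2 : u ^ m = u ^ k * u ^ (m - k) := by rw [← pow_add]; congr 1; omega
        rw [h2] at h1
        apply mul_left_cancel₀ (pow_ne_zero k hu)
        rw [h1]; ring)
    have h0 := congrFun this 0
    have : m - k ≠ 0 := by omega
    simpa [this] using h0

theorem fwd {g : (Fin 2 → ℝ) → ℝ} (hg : Continuous g) {P Q : MvPolynomial (Fin 2) ℝ}
    (hPQ : ∀ x, eval x P = g x * eval x Q) {m : ℕ}
    (hm : ∀ d < m, homogeneousComponent d Q = 0)
    (hpd : ∀ v : ℝ, eval ![1, v] (homogeneousComponent m Q) ≠ 0) :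
    ∃ r s : MvPolynomial (Fin 2) ℝ, (∀ v : ℝ, eval ![0, v] s ≠ 0) ∧
      ∀ u v : ℝ, eval ![u, v] s ≠ 0 → g ![u, u * v] = eval ![u, v] r / eval ![u, v] s := by
  obtain ⟨ρ, hρ, -⟩ := blow P m (order_le hg hPQ hm)
  obtain ⟨σ, hσ, hσ0⟩ := blow Q m hm
  refine ⟨ρ, σ, fun v => by rw [hσ0]; exact hpd v, fun u v hs => ?_⟩
  rw [eq_div_iff hs]
  have := eq_of_ne (F := fun u => g ![u, u * v] * eval ![u, v] σ)
      (G := fun u => eval ![u, v] ρ)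
      ((hg.comp (by fun_prop)).mul (cont_eval σ v)) (cont_eval ρ v) (by
        intro u hu
        have h1 := hPQ ![u, u * v]
        rw [hρ, hσ] at h1
        apply mul_left_cancel₀ (pow_ne_zero m hu)
        rw [h1]; ring)
  exact congrFun this u

theorem bwd {g : (Fin 2 → ℝ) → ℝ} {P Q : MvPolynomial (Fin 2) ℝ} (hcop : IsRelPrime P Q)
    (hPQ : ∀ x, eval x P = g x * eval x Q) {m : ℕ}
    (hm : ∀ d < m, homogeneousComponent d Q = 0) (hm0 : homogeneousComponent m Q ≠ 0)
    {r s : MvPolynomial (Fin 2) ℝ} (hs : ∀ v : ℝ, eval ![0, v] s ≠ 0)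
    (hrs : ∀ u v : ℝ, eval ![u, v] s ≠ 0 →
      g ![u, u * v] = eval ![u, v] r / eval ![u, v] s) (v : ℝ) :
    eval ![1, v] (homogeneousComponent m Q) ≠ 0 := by
  obtain ⟨σ, hσ, hσ0⟩ := blow Q m hm
  obtain ⟨n1, h1⟩ := unblow r
  obtain ⟨n2, h2⟩ := unblow s
  obtain ⟨R, hR⟩ := h1 (n1 + n2) (by omega)
  obtain ⟨S, hS⟩ := h2 (n1 + n2) (by omega)
  set N := n1 + n2
  have hs0 : s ≠ 0 := by
    rintro rfl; exact hs 0 (map_zero _)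
  have hXσ : ¬ (X 0 : MvPolynomial (Fin 2) ℝ) ∣ σ := by
    rintro ⟨w, rfl⟩
    apply hm0
    apply hom_eq_zero (homogeneousComponent_isHomogeneous m Q)
    intro v
    rw [← hσ0]; simp
  have hS0 : S ≠ 0 := by
    rintro rfl
    have : X 0 ^ N * s = 0 := by
      apply MvPolynomial.funext
      intro x
      have := hS (x 0) (x 1)
      rw [← vec_eta] at this
      simpa using this.symm
    rcases mul_eq_zero.mp this with h | h
    · exact pow_ne_zero _ (X_ne_zero 0) h
    · exact hs0 h
  have key : (X 0 * S) * (S * P - R * Q) = 0 := by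
    apply MvPolynomial.funext
    intro x
    simp only [map_mul, map_sub, eval_X, map_zero]
    by_cases hx : x 0 = 0
    · simp [hx]
    · obtain ⟨v, hv⟩ : ∃ v, x 1 = x 0 * v := ⟨x 1 / x 0, by field_simp⟩
      have e : x = ![x 0, x 0 * v] := by rw [← hv]; exact vec_eta x
      have a1 := hS (x 0) v
      have a2 := hR (x 0) v
      have a3 := hrs (x 0) v
      rw [← e] at a1 a2 a3
      by_cases hz : eval ![x 0, v] s = 0
      · simp [a1, hz]
      · have a4 := a3 hz
        rw [eq_div_iff hz] at a4
        rw [a1, a2, hPQ, ← a4]; ring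
  have hSP : S * P = R * Q := by
    have := (mul_eq_zero.mp key).resolve_left (mul_ne_zero (X_ne_zero 0) hS0)
    exact sub_eq_zero.mp this
  have hdvd : Q ∣ S := hcop.symm.dvd_of_dvd_mul_right ⟨R, by rw [hSP]; ring⟩
  obtain ⟨T, hT⟩ := hdvd
  have e1 : X 0 ^ N * s = σ * (X 0 ^ m * bind₁ ![X 0, X 0 * X 1] T) := by
    apply MvPolynomial.funext
    intro x
    have b1 := hS (x 0) (x 1)
    have b2 := hσ (x 0) (x 1)
    have b3 : eval x (bind₁ ![X 0, X 0 * X 1] T) = eval ![x 0, x 0 * x 1] T := by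
      rw [← coe_aeval_eq_eval, RingHom.coe_coe, aeval_bind₁, ← coe_aeval_eq_eval, RingHom.coe_coe]
      congr 2
      ext i; fin_cases i <;> simp
    rw [hT, map_mul, b2, ← vec_eta] at b1
    simp only [map_mul, map_pow, eval_X]
    rw [← b1, b3]; ring
  obtain ⟨w, hw⟩ := (X_prime (R := ℝ) (i := (0 : Fin 2))).pow_dvd_of_dvd_mul_left N hXσ
    (Dvd.intro _ e1)
  rw [hw] at e1
  have e2 : s = σ * w := by
    apply mul_left_cancel₀ (pow_ne_zero N (X_ne_zero (R := ℝ) (0 : Fin 2)))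
    rw [e1]; ring
  intro h0
  apply hs v
  rw [e2, map_mul, hσ0, h0, zero_mul]

theorem nonneg {Q : MvPolynomial (Fin 2) ℝ} (hQ : ∀ x, 0 ≤ eval x Q) {m : ℕ}
    (hm : ∀ d < m, homogeneousComponent d Q = 0) (y : Fin 2 → ℝ) (hy : y 0 ≠ 0) :
    0 ≤ eval y (homogeneousComponent m Q) := by
  obtain ⟨σ, hσ, hσ0⟩ := blow Q m hm
  obtain ⟨v, hv⟩ : ∃ v, y 1 = y 0 * v := ⟨y 1 / y 0, by field_simp⟩
  have e : y = ![y 0, y 0 * v] := by rw [← hv]; exact vec_eta y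
  rw [e, eval_hom (homogeneousComponent_isHomogeneous m Q), ← hσ0]
  have hc : Continuous fun t : ℝ => (y 0) ^ m * eval ![t * y 0, v] σ :=
    continuous_const.mul ((cont_eval σ v).comp (continuous_id.mul continuous_const))
  have hl : Filter.Tendsto (fun t : ℝ => (y 0) ^ m * eval ![t * y 0, v] σ)
      (nhdsWithin 0 (Set.Ioi 0)) (nhds ((y 0) ^ m * eval ![0, v] σ)) := by
    have := (hc.tendsto 0).mono_left (nhdsWithin_le_nhds (s := Set.Ioi 0))
    simpa using this
  refine ge_of_tendsto hl ?_
  filter_upwards [self_mem_nhdsWithin] with t ht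
  have h1 := hQ ![t * y 0, t * y 0 * v]
  rw [hσ, mul_pow, mul_assoc] at h1
  exact nonneg_of_mul_nonneg_right h1 (pow_pos ht m)

theorem relPrime_map (φ ψ : MvPolynomial (Fin 2) ℝ →ₐ[ℝ] MvPolynomial (Fin 2) ℝ)
    (h1 : ∀ x, ψ (φ x) = x) (h2 : ∀ x, φ (ψ x) = x) {P Q : MvPolynomial (Fin 2) ℝ}
    (h : IsRelPrime P Q) : IsRelPrime (φ P) (φ Q) := by
  intro d hP hQ
  have := h (d := ψ d) (by simpa [h1] using map_dvd ψ hP) (by simpa [h1] using map_dvd ψ hQ)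
  simpa [h2] using this.map φ

theorem eval_shift (a y : Fin 2 → ℝ) (q : MvPolynomial (Fin 2) ℝ) :
    eval y (shiftPoly a q) = eval (a + y) q := by
  unfold shiftPoly
  rw [← coe_aeval_eq_eval, RingHom.coe_coe, aeval_bind₁, ← coe_aeval_eq_eval, RingHom.coe_coe]
  congr 2
  ext i; simp

theorem shift_neg (a : Fin 2 → ℝ) (q : MvPolynomial (Fin 2) ℝ) :
    shiftPoly (-a) (shiftPoly a q) = q := by
  apply MvPolynomial.funext
  intro x
  rw [eval_shift, eval_shift]; simp

theorem shift_neg' (a : Fin 2 → ℝ) (q : MvPolynomial (Fin 2) ℝ) :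
    shiftPoly a (shiftPoly (-a) q) = q := by
  apply MvPolynomial.funext
  intro x
  rw [eval_shift, eval_shift]; simp

theorem shift_relPrime (a : Fin 2 → ℝ) {P Q : MvPolynomial (Fin 2) ℝ} (h : IsRelPrime P Q) :
    IsRelPrime (shiftPoly a P) (shiftPoly a Q) :=
  relPrime_map (bind₁ (fun i => C (a i) + X i)) (bind₁ (fun i => C ((-a) i) + X i))
    (shift_neg a) (shift_neg' a) h

noncomputable def sw : MvPolynomial (Fin 2) ℝ →ₐ[ℝ] MvPolynomial (Fin 2) ℝ :=
  rename (Equiv.swap (0 : Fin 2) 1)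

theorem eval_sw (x : Fin 2 → ℝ) (q : MvPolynomial (Fin 2) ℝ) :
    eval x (sw q) = eval ![x 1, x 0] q := by
  rw [sw, eval_rename]
  congr 2
  ext i; fin_cases i <;> simp

theorem sw_sw (q : MvPolynomial (Fin 2) ℝ) : sw (sw q) = q := by
  apply MvPolynomial.funext
  intro x
  rw [eval_sw, eval_sw]
  simp [← vec_eta]

theorem hc_sw (d : ℕ) (q : MvPolynomial (Fin 2) ℝ) :
    homogeneousComponent d (sw q) = sw (homogeneousComponent d q) :=
  (rename_homogeneousComponent d q).symm

end BlowAux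

/-- a continuous rational function `f = p/q` on `ℝ²` (with `p, q` coprime,
`q ≥ 0`, `Z(q)` finite) becomes regular after blowing up each point of `Z(q)` if and only
if at every point of `Z(q)` the lowest-degree homogeneous component of `q` is positive
definite. -/
theorem regular_after_one_blowup_iff_locally_positive_definite
    (f : (Fin 2 → ℝ) → ℝ) (hf : Continuous f)
    (p q : MvPolynomial (Fin 2) ℝ) (hcop : IsRelPrime p q) (hq : q ≠ 0)
    (hqpos : ∀ x : Fin 2 → ℝ, 0 ≤ eval x q)
    (hfin : {x : Fin 2 → ℝ | eval x q = 0}.Finite)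
    (hrep : ∀ x : Fin 2 → ℝ, eval x q ≠ 0 → f x = eval x p / eval x q) :
    (∀ a : Fin 2 → ℝ, eval a q = 0 → LocPosDef q a) ↔
    (∀ a : Fin 2 → ℝ, eval a q = 0 →
      ∃ r₁ s₁ r₂ s₂ : MvPolynomial (Fin 2) ℝ,
        (∀ v : ℝ, eval ![0, v] s₁ ≠ 0) ∧
        (∀ u : ℝ, eval ![u, 0] s₂ ≠ 0) ∧
        (∀ u v : ℝ, eval ![u, v] s₁ ≠ 0 →
          f ![a 0 + u, a 1 + u * v] = eval ![u, v] r₁ / eval ![u, v] s₁) ∧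
        (∀ u v : ℝ, eval ![u, v] s₂ ≠ 0 →
          f ![a 0 + u * v, a 1 + v] = eval ![u, v] r₂ / eval ![u, v] s₂)) := by
  have hall : ∀ x, eval x p = f x * eval x q := by
    have hd : Dense ({x : Fin 2 → ℝ | eval x q = 0}ᶜ) := hfin.countable.dense_compl ℝ
    have := Continuous.ext_on hd (MvPolynomial.continuous_eval p)
      (hf.mul (MvPolynomial.continuous_eval q)) (fun x hx => by
        have h := hrep x hx
        rw [eq_div_iff hx] at h
        exact h.symm)
    exact fun x => congrFun this x
  refine forall_congr' fun a => imp_congr_right fun _ => ?_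
  set Q := shiftPoly a q with hQ
  set P := shiftPoly a p with hP
  have hg : Continuous fun y => f (a + y) := hf.comp (by fun_prop)
  have hg' : Continuous fun y : Fin 2 → ℝ => f (a + ![y 1, y 0]) := hf.comp (by fun_prop)
  have hPQ : ∀ x, eval x P = f (a + x) * eval x Q := fun x => by
    rw [hQ, hP, BlowAux.eval_shift, BlowAux.eval_shift, hall]
  have hPQ' : ∀ x : Fin 2 → ℝ, eval x (BlowAux.sw P)
      = f (a + ![x 1, x 0]) * eval x (BlowAux.sw Q) := fun x => by
    rw [BlowAux.eval_sw, BlowAux.eval_sw, hPQ]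
  have hv1 : ∀ u v : ℝ, a + ![u, u * v] = ![a 0 + u, a 1 + u * v] := fun u v => by
    ext i; fin_cases i <;> simp
  have hv2 : ∀ u v : ℝ, a + ![u * v, v] = ![a 0 + u * v, a 1 + v] := fun u v => by
    ext i; fin_cases i <;> simp
  constructor
  · rintro ⟨m, hm0, hm, hpd⟩
    obtain ⟨r₁, s₁, h1, h2⟩ := BlowAux.fwd hg hPQ hm (fun v => (hpd _ (fun h => by
      simpa using congrFun h 0)).ne')
    obtain ⟨r₂, s₂, h3, h4⟩ := BlowAux.fwd hg' hPQ' (m := m)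
      (fun d hd => by rw [BlowAux.hc_sw, hm d hd, map_zero]) (fun v => by
        rw [BlowAux.hc_sw, BlowAux.eval_sw]
        exact (hpd _ (fun h => by simpa using congrFun h 1)).ne')
    refine ⟨r₁, s₁, BlowAux.sw r₂, BlowAux.sw s₂, h1, ?_, ?_, ?_⟩
    · intro u
      rw [BlowAux.eval_sw]; exact h3 u
    · intro u v h
      rw [← hv1]; exact h2 u v h
    · intro u v h
      rw [BlowAux.eval_sw] at h
      rw [BlowAux.eval_sw, BlowAux.eval_sw, ← hv2, mul_comm u v]
      exact h4 v u h
  · rintro ⟨r₁, s₁, r₂, s₂, h1, h2, h3, h4⟩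
    have hQ0 : Q ≠ 0 := by
      intro h
      apply hq
      rw [← BlowAux.shift_neg a q, ← hQ, h]
      simp [shiftPoly]
    have hex : ∃ m, homogeneousComponent m Q ≠ 0 := by
      by_contra! h
      apply hQ0
      rw [← sum_homogeneousComponent Q]
      exact Finset.sum_eq_zero fun i _ => h i
    classical
    obtain ⟨m, hm0, hm⟩ : ∃ m, homogeneousComponent m Q ≠ 0 ∧
        ∀ d < m, homogeneousComponent d Q = 0 :=
      ⟨Nat.find hex, Nat.find_spec hex, fun d hd => not_not.mp (Nat.find_min hex hd)⟩
    have hcop1 : IsRelPrime P Q := BlowAux.shift_relPrime a hcop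
    have hcop2 : IsRelPrime (BlowAux.sw P) (BlowAux.sw Q) :=
      BlowAux.relPrime_map _ _ BlowAux.sw_sw BlowAux.sw_sw hcop1
    have hm' : ∀ d < m, homogeneousComponent d (BlowAux.sw Q) = 0 := fun d hd => by
      rw [BlowAux.hc_sw, hm d hd, map_zero]
    have hm0' : homogeneousComponent m (BlowAux.sw Q) ≠ 0 := fun h => by
      rw [BlowAux.hc_sw] at h
      apply hm0
      rw [← BlowAux.sw_sw (homogeneousComponent m Q), h, map_zero]
    have b1 := BlowAux.bwd (g := fun y => f (a + y)) hcop1 hPQ hm hm0 (r := r₁) h1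
      (fun u v h => by rw [hv1]; exact h3 u v h)
    have b2 := BlowAux.bwd (g := fun y : Fin 2 → ℝ => f (a + ![y 1, y 0])) hcop2 hPQ' hm' hm0'
      (r := BlowAux.sw r₂) (s := BlowAux.sw s₂)
      (fun v => by rw [BlowAux.eval_sw]; exact h2 v)
      (fun u v h => by
        rw [BlowAux.eval_sw] at h
        rw [BlowAux.eval_sw, BlowAux.eval_sw]
        have := h4 v u h
        rw [← hv2, mul_comm v u] at this
        exact this)
    have hQn : ∀ x, 0 ≤ eval x Q := fun x => by
      rw [hQ, BlowAux.eval_shift]; exact hqpos _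
    have hQn' : ∀ x, 0 ≤ eval x (BlowAux.sw Q) := fun x => by
      rw [BlowAux.eval_sw]; exact hQn _
    -- positivity at points with nonzero first coordinate
    have pos : ∀ (Q : MvPolynomial (Fin 2) ℝ), (∀ x, 0 ≤ eval x Q) →
        (∀ d < m, homogeneousComponent d Q = 0) →
        (∀ v : ℝ, eval ![1, v] (homogeneousComponent m Q) ≠ 0) → ∀ y : Fin 2 → ℝ, y 0 ≠ 0 →
        0 < eval y (homogeneousComponent m Q) := by
      intro Q hQn hm hb y hy
      refine lt_of_le_of_ne (BlowAux.nonneg hQn hm y hy) (Ne.symm ?_)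
      have e : y = ![y 0, y 0 * (y 1 / y 0)] := by
        rw [mul_div_cancel₀ _ hy]; exact BlowAux.vec_eta y
      rw [e, BlowAux.eval_hom (homogeneousComponent_isHomogeneous m Q)]
      exact mul_ne_zero (pow_ne_zero _ hy) (hb _)
    refine ⟨m, hm0, hm, fun y hy => ?_⟩
    by_cases hy0 : y 0 = 0
    · have hy1 : y 1 ≠ 0 := fun h => hy (by
        rw [BlowAux.vec_eta y, hy0, h]; ext i; fin_cases i <;> rfl)
      have := pos _ hQn' hm' b2 ![y 1, y 0] (by simpa using hy1)
      rw [BlowAux.hc_sw, BlowAux.eval_sw] at this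
      simpa [← BlowAux.vec_eta] using this
    · exact pos Q hQn hm b1 y hy0
end

section
/- Let k ∈ ℕ. Let f : ℝ² → ℝ be [1]-regulous and of class C^k (i.e., f ∈ R^k_{[1]}(ℝ²)), with relatively prime representation f = p/q as in the definition of [1]-regulous, and let h ∈ R^{k+1}_{[1]}(ℝ²) be such that Z(q) ⊆ h⁻¹(0). Then the pointwise product h·f belongs to R^{k+1}_{[1]}(ℝ²), i.e., h·f is [1]-regulous and of class C^{k+1} on ℝ². -/
open MvPolynomial

namespace Reg

open Filter Topology Asymptotics

abbrev E2 := Fin 2 → ℝ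
abbrev P2 := MvPolynomial (Fin 2) ℝ
noncomputable abbrev I2 : Ideal P2 := idealOfVars (Fin 2) ℝ

lemma mem_iff_comp (P : P2) (n : ℕ) :
    P ∈ I2 ^ n ↔ ∀ d < n, homogeneousComponent d P = 0 := by
  rw [mem_pow_idealOfVars_iff']
  constructor
  · intro h d hd
    ext s
    rw [coeff_homogeneousComponent]
    split_ifs with h1
    · simpa using h s (h1 ▸ hd)
    · simp
  · intro h s hs
    have := congrArg (coeff s) (h _ hs)
    simpa [coeff_homogeneousComponent] using this

lemma sub_comp_mem (P : P2) (n : ℕ) (h : P ∈ I2 ^ n) :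
    P - homogeneousComponent n P ∈ I2 ^ (n + 1) := by
  rw [mem_pow_idealOfVars_iff'] at *
  intro s hs
  rw [coeff_sub, coeff_homogeneousComponent]
  split_ifs with h1
  · simp
  · simp [h s (by omega)]

lemma comp_mem (P : P2) (n : ℕ) : homogeneousComponent n P ∈ I2 ^ n := by
  rw [mem_pow_idealOfVars_iff']
  intro s hs
  rw [coeff_homogeneousComponent, if_neg (by omega)]

lemma comp_mul (P Q : P2) (a b : ℕ) (hP : P ∈ I2 ^ a) (hQ : Q ∈ I2 ^ b) :
    homogeneousComponent (a + b) (P * Q)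
      = homogeneousComponent a P * homogeneousComponent b Q := by
  have h1 : (P - homogeneousComponent a P) * Q ∈ I2 ^ (a + b + 1) := by
    have := Ideal.mul_mem_mul (sub_comp_mem P a hP) hQ
    rw [← pow_add] at this
    convert this using 2; ring
  have h2 : homogeneousComponent a P * (Q - homogeneousComponent b Q) ∈ I2 ^ (a + b + 1) := by
    have := Ideal.mul_mem_mul (comp_mem P a) (sub_comp_mem Q b hQ)
    rw [← pow_add] at this
    convert this using 2; ring
  have e : P * Q = homogeneousComponent a P * homogeneousComponent b Q +
     ((P - homogeneousComponent a P) * Q +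
      homogeneousComponent a P * (Q - homogeneousComponent b Q)) := by ring
  have h3 := (mem_iff_comp _ _).1 (add_mem h1 h2) (a + b) (by omega)
  conv_lhs => rw [e, map_add, h3, add_zero]
  have := ((homogeneousComponent_isHomogeneous a P).mul (homogeneousComponent_isHomogeneous b Q))
  rw [homogeneousComponent_eq_self this]

lemma pderiv_mem (P : P2) (n : ℕ) (i : Fin 2) (h : P ∈ I2 ^ n) : pderiv i P ∈ I2 ^ (n - 1) := by
  rw [mem_pow_idealOfVars_iff'] at *
  intro s hs
  rw [coeff_pderiv, h, zero_mul]
  simp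
  omega

lemma eval_bound (P : P2) (n : ℕ) (h : P ∈ I2 ^ n) :
    ∃ K : ℝ, 0 ≤ K ∧ ∀ x : E2, ‖x‖ ≤ 1 → |eval x P| ≤ K * ‖x‖ ^ n := by
  refine ⟨∑ s ∈ P.support, |coeff s P|, Finset.sum_nonneg (fun _ _ => abs_nonneg _), ?_⟩
  intro x hx
  rw [eval_eq, Finset.sum_mul]
  refine (Finset.abs_sum_le_sum_abs _ _).trans (Finset.sum_le_sum fun s hs => ?_)
  rw [abs_mul]
  gcongr
  rw [mem_pow_idealOfVars_iff] at h
  have h1 : |∏ i ∈ s.support, x i ^ s i| ≤ ‖x‖ ^ s.degree := by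
    rw [Finset.abs_prod, Finsupp.degree_apply, ← Finset.prod_pow_eq_pow_sum]
    refine Finset.prod_le_prod (fun _ _ => abs_nonneg _) fun i _ => ?_
    rw [abs_pow]
    gcongr
    exact norm_le_pi_norm x i
  exact h1.trans (pow_le_pow_of_le_one (norm_nonneg _) hx (h s hs))

lemma ev_norm_le : ∀ᶠ x : E2 in 𝓝 0, ‖x‖ ≤ 1 := by
  filter_upwards [Metric.ball_mem_nhds (0 : E2) one_pos] with x hx
  simpa using (mem_ball_zero_iff.1 hx).le

lemma eval_isBigO (P : P2) (n : ℕ) (h : P ∈ I2 ^ n) :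
    (fun x : E2 => eval x P) =O[𝓝 0] fun x => ‖x‖ ^ n := by
  obtain ⟨K, -, hK⟩ := eval_bound P n h
  refine IsBigO.of_bound K ?_
  filter_upwards [ev_norm_le] with x hx
  simpa using hK x hx

lemma eval_comp_smul (P : P2) (n : ℕ) (y : E2) (t : ℝ) :
    eval (t • y) (homogeneousComponent n P) = t ^ n * eval y (homogeneousComponent n P) := by
  rw [eval_eq, eval_eq, Finset.mul_sum]
  refine Finset.sum_congr rfl fun s hs => ?_
  have hd : s.degree = n := by
    rw [mem_support_iff, coeff_homogeneousComponent] at hs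
    by_contra hne
    simp [hne] at hs
  have : ∏ i ∈ s.support, (t • y) i ^ s i = t ^ n * ∏ i ∈ s.support, y i ^ s i := by
    rw [← hd, Finsupp.degree_apply]
    simp [mul_pow, Finset.prod_mul_distrib, Finset.prod_pow_eq_pow_sum]
  rw [this]; ring

lemma tendsto_comp (P : P2) (n : ℕ) (h : P ∈ I2 ^ n) (y : E2) :
    Tendsto (fun t : ℝ => eval (t • y) P / t ^ n) (𝓝[>] 0)
      (𝓝 (eval y (homogeneousComponent n P))) := by
  have key : ∀ t : ℝ, eval (t • y) (homogeneousComponent n P)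
      = t ^ n * eval y (homogeneousComponent n P) := by
    exact fun t => eval_comp_smul P n y t
  have hty : Tendsto (fun t : ℝ => t • y) (𝓝[>] 0) (𝓝 0) := by
    have : Tendsto (fun t : ℝ => t • y) (𝓝 0) (𝓝 ((0:ℝ) • y)) := by
      exact (Continuous.tendsto (by fun_prop) 0)
    rw [zero_smul] at this
    exact this.mono_left nhdsWithin_le_nhds
  have h1 := (eval_isBigO _ _ (sub_comp_mem P n h)).comp_tendsto hty
  have h2 : (fun t : ℝ => eval (t • y) P / t ^ n - eval y (homogeneousComponent n P))
      =O[𝓝[>] 0] fun t : ℝ => t := by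
    obtain ⟨K, hK⟩ := h1.bound
    refine IsBigO.of_bound (K * ‖y‖ ^ (n + 1)) ?_
    filter_upwards [hK, self_mem_nhdsWithin] with t ht ht0
    have ht0 : 0 < t := ht0
    simp only [Function.comp, map_sub, key, norm_pow, norm_norm, norm_smul, norm_mul] at ht
    have e : eval (t • y) P / t ^ n - eval y (homogeneousComponent n P)
      = (eval (t • y) P - t ^ n * eval y (homogeneousComponent n P)) / t ^ n := by
      field_simp
    have htn : 0 < ‖t‖ := norm_pos_iff.2 ht0.ne'
    rw [e, norm_div, norm_pow, div_le_iff₀ (by positivity)]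
    refine ht.trans (le_of_eq ?_)
    ring
  have h3 := h2.trans_tendsto (tendsto_id.mono_left nhdsWithin_le_nhds)
  simpa using h3.add_const (eval y (homogeneousComponent n P))

lemma comp_eq_zero (P : P2) (n : ℕ) (h : ∀ y : E2, y ≠ 0 → eval y (homogeneousComponent n P) = 0) :
    homogeneousComponent n P = 0 := by
  have : homogeneousComponent n P * X 0 = 0 := by
    refine MvPolynomial.funext fun y => ?_
    by_cases hy : y = 0
    · simp [hy]
    · simp [h y hy]
  exact (mul_eq_zero.1 this).resolve_right (X_ne_zero 0)

lemma mem_of_isLittleO (P : P2) (M : ℕ)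
    (h : (fun x : E2 => eval x P) =o[𝓝[≠] 0] fun x => ‖x‖ ^ M) : P ∈ I2 ^ (M + 1) := by
  have : ∀ d, d ≤ M + 1 → P ∈ I2 ^ d := by
    intro d
    induction d with
    | zero => simp
    | succ d ih =>
      intro hd
      have hP := ih (by omega)
      have hz : homogeneousComponent d P = 0 := by
        refine comp_eq_zero _ _ fun y hy => ?_
        refine tendsto_nhds_unique (tendsto_comp P d hP y) ?_
        have hty : Tendsto (fun t : ℝ => t • y) (𝓝[>] 0) (𝓝[≠] 0) := by
          refine tendsto_nhdsWithin_iff.2 ⟨?_, ?_⟩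
          · have : Tendsto (fun t : ℝ => t • y) (𝓝 0) (𝓝 ((0:ℝ) • y)) := by
              exact (Continuous.tendsto (by fun_prop) 0)
            rw [zero_smul] at this
            exact this.mono_left nhdsWithin_le_nhds
          · filter_upwards [self_mem_nhdsWithin] with t ht
            exact smul_ne_zero (ne_of_gt ht) hy
        have h2 : (fun x : E2 => ‖x‖ ^ M) =O[𝓝[≠] 0] fun x => ‖x‖ ^ d := by
          refine IsBigO.of_bound 1 ?_
          filter_upwards [nhdsWithin_le_nhds ev_norm_le] with x hx
          simpa using pow_le_pow_of_le_one (norm_nonneg _) hx (by omega)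
        have h3 := (h.trans_isBigO h2).comp_tendsto hty
        have h4 : ((fun x : E2 => ‖x‖ ^ d) ∘ fun t : ℝ => t • y) =O[𝓝[>] 0] fun t : ℝ => t ^ d := by
          refine IsBigO.of_bound (‖y‖ ^ d) (Eventually.of_forall fun t => ?_)
          simp [norm_smul, mul_pow, mul_comm]
        exact (h3.trans_isBigO h4).tendsto_div_nhds_zero
      have := sub_comp_mem P d hP
      rwa [hz, sub_zero] at this
  exact this _ le_rfl

lemma lower_bound (P : P2) (m : ℕ) (h : P ∈ I2 ^ m)
    (hpos : ∀ y : E2, y ≠ 0 → 0 < eval y (homogeneousComponent m P)) :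
    ∃ c : ℝ, 0 < c ∧ ∀ᶠ x : E2 in 𝓝 0, c * ‖x‖ ^ m ≤ eval x P := by
  obtain ⟨y0, hy0, hmin⟩ := (isCompact_sphere (0 : E2) 1).exists_isMinOn
    (NormedSpace.sphere_nonempty.2 zero_le_one)
    (MvPolynomial.continuous_eval (homogeneousComponent m P)).continuousOn
  set c := eval y0 (homogeneousComponent m P) with hc
  have hcpos : 0 < c := hpos y0 (by rintro rfl; simp at hy0)
  have hlow : ∀ x : E2, x ≠ 0 → c * ‖x‖ ^ m ≤ eval x (homogeneousComponent m P) := by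
    intro x hx
    have hn : 0 < ‖x‖ := norm_pos_iff.2 hx
    have e : x = ‖x‖ • (‖x‖⁻¹ • x) := by rw [smul_smul, mul_inv_cancel₀ hn.ne', one_smul]
    have h1 : c ≤ eval (‖x‖⁻¹ • x) (homogeneousComponent m P) :=
      hmin (by simp [norm_smul, hn.ne'])
    conv_rhs => rw [e, eval_comp_smul]
    rw [mul_comm]
    gcongr
  obtain ⟨K, hK0, hK⟩ := eval_bound _ _ (sub_comp_mem P m h)
  refine ⟨c / 2, by positivity, ?_⟩
  have hsmall : ∀ᶠ x : E2 in 𝓝 0, K * ‖x‖ < c / 2 := by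
    have : Tendsto (fun x : E2 => K * ‖x‖) (𝓝 0) (𝓝 (K * ‖(0 : E2)‖)) :=
      Continuous.tendsto (by fun_prop) 0
    rw [norm_zero, mul_zero] at this
    exact this.eventually_lt_const (by positivity)
  filter_upwards [hsmall, ev_norm_le] with x hx hx1
  have h1 : c * ‖x‖ ^ m ≤ eval x (homogeneousComponent m P) := by
    by_cases hx0 : x = 0
    · have := eval_comp_smul P m y0 0
      rw [zero_smul] at this
      rw [hx0, this, norm_zero, mul_comm]
    · exact hlow x hx0
  have h2 := (abs_le.1 (hK x hx1)).1
  rw [map_sub] at h2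
  have h3 : K * ‖x‖ ^ (m + 1) ≤ c / 2 * ‖x‖ ^ m := by
    calc K * ‖x‖ ^ (m + 1) = (K * ‖x‖) * ‖x‖ ^ m := by ring
      _ ≤ _ := by gcongr
  linarith

lemma hasFDerivAt_eval (P : P2) (x : E2) :
    HasFDerivAt (fun x : E2 => eval x P)
      (∑ i, eval x (pderiv i P) • ContinuousLinearMap.proj (R := ℝ) (φ := fun _ : Fin 2 => ℝ) i) x := by
  induction P using MvPolynomial.induction_on with
  | C a => simpa using hasFDerivAt_const a x
  | add p q hp hq =>
    have e : (fun x : E2 => eval x (p + q)) = fun x => eval x p + eval x q := by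
      funext x; simp
    rw [e]
    refine (hp.add hq).congr_fderiv ?_
    simp only [map_add, add_smul, Finset.sum_add_distrib]
  | mul_X p i hp =>
    have e : (fun x : E2 => eval x (p * X i)) = fun x => eval x p * x i := by
      funext x; simp
    rw [e]
    refine (hp.mul (hasFDerivAt_apply (𝕜 := ℝ) i x)).congr_fderiv ?_
    ext v
    fin_cases i <;> simp [Fin.sum_univ_two, pderiv_X] <;> ring

lemma contDiff_eval (P : P2) {n : WithTop ℕ∞} : ContDiff ℝ n (fun x : E2 => eval x P) := by
  induction P using MvPolynomial.induction_on with
  | C a => simpa using contDiff_const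
  | add p q hp hq => simpa using hp.add hq
  | mul_X p i hp => simpa using hp.mul (contDiff_apply ℝ ℝ i)

/-- radial primitive -/
lemma radial (i : Fin 2) (S : P2) : ∃ T : P2, eval 0 T = 0 ∧ ∀ (x : E2) (t : ℝ),
    HasDerivAt (fun t : ℝ => eval (t • x) T) (x i * eval (t • x) S) t := by
  induction S using MvPolynomial.induction_on' with
  | monomial s c =>
    refine ⟨C (((s.degree : ℝ) + 1)⁻¹) * (X i * monomial s c), by simp, fun x t => ?_⟩
    have key : ∀ t : ℝ, eval (t • x) (monomial s c) = t ^ s.degree * eval x (monomial s c) := by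
      intro t
      simp [eval_monomial, Finsupp.prod, mul_pow, Finset.prod_mul_distrib, Finsupp.degree_apply,
        Finset.prod_pow_eq_pow_sum]
      ring
    have h := ((hasDerivAt_pow (s.degree + 1) t).const_mul
      (((s.degree : ℝ) + 1)⁻¹ * x i * eval x (monomial s c)))
    have hne : ((s.degree : ℝ) + 1) ≠ 0 := by positivity
    have e : (fun t : ℝ => eval (t • x) (C (((s.degree : ℝ) + 1)⁻¹) * (X i * monomial s c)))
        = fun t : ℝ => ((s.degree : ℝ) + 1)⁻¹ * x i * eval x (monomial s c) * t ^ (s.degree + 1) := by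
      funext t
      simp only [map_mul, eval_C, eval_X, key, Pi.smul_apply, smul_eq_mul]
      ring
    rw [e, key]
    refine h.congr_deriv ?_
    rw [Nat.add_sub_cancel]
    push_cast
    field_simp
  | add p q hp hq =>
    obtain ⟨T1, h1, h1'⟩ := hp
    obtain ⟨T2, h2, h2'⟩ := hq
    refine ⟨T1 + T2, by rw [map_add, h1, h2, add_zero], fun x t => ?_⟩
    have e : (fun t : ℝ => eval (t • x) (T1 + T2)) = fun t => eval (t • x) T1 + eval (t • x) T2 := by
      funext t; simp
    rw [e, map_add, mul_add]
    exact (h1' x t).add (h2' x t)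

end Reg

namespace Reg

open Filter Topology Asymptotics

lemma taylor (k : ℕ) : ∀ f : E2 → ℝ, ContDiff ℝ k f →
    ∃ T : P2, (fun x => f x - eval x T) =o[𝓝 0] fun x => ‖x‖ ^ k := by
  induction k with
  | zero =>
    intro f hf
    refine ⟨C (f 0), ?_⟩
    simp only [eval_C, pow_zero]
    rw [isLittleO_one_iff]
    have := (hf.continuous.tendsto 0).sub_const (f 0)
    simpa using this
  | succ k ih =>
    intro f hf
    have hfd : Differentiable ℝ f := hf.differentiable (by simp)
    have hD : ContDiff ℝ k (fderiv ℝ f) := hf.fderiv_right (by norm_cast)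
    have hi : ∀ i : Fin 2, ∃ T : P2,
        (fun x => fderiv ℝ f x (Pi.single i 1) - eval x T) =o[𝓝 0] fun x => ‖x‖ ^ k := fun i =>
      ih _ (hD.clm_apply contDiff_const)
    choose S hS using hi
    choose R hR0 hR using fun i => radial i (S i)
    refine ⟨C (f 0) + ∑ i, R i, ?_⟩
    rw [isLittleO_iff]
    intro c hc
    have hev : ∀ᶠ x : E2 in 𝓝 0, ∀ i,
        ‖fderiv ℝ f x (Pi.single i 1) - eval x (S i)‖ ≤ c / 2 * ‖x‖ ^ k := by
      refine eventually_all.2 fun i => ?_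
      have := (isLittleO_iff.1 (hS i)) (half_pos hc)
      simpa using this
    obtain ⟨ε, hε, hball⟩ := Metric.eventually_nhds_iff_ball.1 hev
    filter_upwards [Metric.ball_mem_nhds (0 : E2) hε] with x hx
    have hx' : ‖x‖ < ε := by simpa using hx
    set φ : ℝ → ℝ := fun t => f (t • x) - ∑ i, eval (t • x) (R i) with hφ
    have hder : ∀ t : ℝ, HasDerivAt φ
        (∑ i, x i * (fderiv ℝ f (t • x) (Pi.single i 1) - eval (t • x) (S i))) t := by
      intro t
      have h1 : HasDerivAt (fun t : ℝ => t • x) x t := by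
        simpa using (hasDerivAt_id t).smul_const x
      have h2 : HasDerivAt (fun t : ℝ => f (t • x)) (fderiv ℝ f (t • x) x) t :=
        (hfd (t • x)).hasFDerivAt.comp_hasDerivAt t h1
      have h3 : HasDerivAt (fun t : ℝ => ∑ i, eval (t • x) (R i))
          (∑ i, x i * eval (t • x) (S i)) t :=
        HasDerivAt.fun_sum fun i _ => hR i x t
      refine (h2.sub h3).congr_deriv ?_
      have h4 : fderiv ℝ f (t • x) x = ∑ i, x i * fderiv ℝ f (t • x) (Pi.single i 1) := by
        have h5 : ∀ L : E2 →L[ℝ] ℝ, L x = ∑ i, x i * L (Pi.single i 1) := by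
          intro L
          conv_lhs => rw [pi_eq_sum_univ' x]
          simp [map_sum]
        exact h5 _
      rw [h4, ← Finset.sum_sub_distrib]
      simp [mul_sub]
    have hb : ∀ t ∈ Set.Icc (0 : ℝ) 1,
        ‖∑ i, x i * (fderiv ℝ f (t • x) (Pi.single i 1) - eval (t • x) (S i))‖
          ≤ c * ‖x‖ ^ (k + 1) := by
      intro t ht
      have htx : ‖t • x‖ ≤ ‖x‖ := by
        rw [norm_smul, Real.norm_eq_abs, abs_of_nonneg ht.1]
        exact mul_le_of_le_one_left (norm_nonneg _) ht.2
      have hm := hball (t • x) (by simpa using htx.trans_lt hx')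
      have : ∀ i, ‖x i * (fderiv ℝ f (t • x) (Pi.single i 1) - eval (t • x) (S i))‖
          ≤ ‖x‖ * (c / 2 * ‖x‖ ^ k) := by
        intro i
        rw [norm_mul]
        have h5 := norm_le_pi_norm x i
        have h6 := hm i
        gcongr
        exact h6.trans (by gcongr)
      refine (norm_sum_le_of_le _ fun i _ => this i).trans (le_of_eq ?_)
      simp
      ring
    have hmv := (convex_Icc (0 : ℝ) 1).norm_image_sub_le_of_norm_hasDerivWithin_le
      (fun t ht => (hder t).hasDerivWithinAt) hb (by simp : (0 : ℝ) ∈ Set.Icc (0 : ℝ) 1) (by simp : (1 : ℝ) ∈ Set.Icc (0 : ℝ) 1)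
    simp only [hφ, one_smul, zero_smul, hR0] at hmv
    simp only [map_add, eval_C, map_sum, norm_pow, norm_norm]
    refine le_trans (le_of_eq ?_) (hmv.trans (by simp))
    congr 1
    simp
    ring

/-- the quotient `N / Q^(j+1)` -/
noncomputable def G (Q N : P2) (j : ℕ) (x : E2) : ℝ := eval x N / eval x Q ^ (j + 1)

/-- numerator of the partial derivative -/
noncomputable def dN (Q N : P2) (j : ℕ) (i : Fin 2) : P2 :=
  pderiv i N * Q - C ((j : ℝ) + 1) * (N * pderiv i Q)

lemma dN_mem (Q N : P2) (j m n : ℕ) (i : Fin 2) (hQ : Q ∈ I2 ^ m)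
    (hN : N ∈ I2 ^ (m * (j + 1) + (n + 1))) : dN Q N j i ∈ I2 ^ (m * (j + 2) + n) := by
  have h1 := Ideal.mul_mem_mul (pderiv_mem N _ i hN) hQ
  have h2 := Ideal.mul_mem_mul hN (pderiv_mem Q _ i hQ)
  rw [← pow_add] at h1 h2
  refine sub_mem (Ideal.pow_le_pow_right ?_ h1) (Ideal.mul_mem_left _ _ (Ideal.pow_le_pow_right ?_ h2))
  · have : m * (j + 2) = m * (j + 1) + m := by ring
    omega
  · have : m * (j + 2) = m * (j + 1) + m := by ring
    omega

lemma G_hasFDerivAt (Q N : P2) (j : ℕ) (x : E2) (hx : eval x Q ≠ 0) :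
    HasFDerivAt (G Q N j) (∑ i, G Q (dN Q N j i) (j + 1) x •
      ContinuousLinearMap.proj (R := ℝ) (φ := fun _ : Fin 2 => ℝ) i) x := by
  have hq := (hasFDerivAt_eval Q x).pow (j + 1)
  have h := (hasFDerivAt_eval N x).mul
    ((hasDerivAt_inv (pow_ne_zero (j + 1) hx)).comp_hasFDerivAt x hq)
  refine (h.congr_of_eventuallyEq (Eventually.of_forall fun y => ?_)).congr_fderiv ?_
  · simp [G, div_eq_mul_inv]
  · ext v
    simp [Fin.sum_univ_two, G, dN]
    field_simp
    ring

lemma G_isBigO (Q N : P2) (j m n : ℕ) (c : ℝ) (hc : 0 < c) (hQ0 : eval 0 Q = 0)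
    (hlow : ∀ᶠ x : E2 in 𝓝 0, c * ‖x‖ ^ m ≤ eval x Q)
    (hN : N ∈ I2 ^ (m * (j + 1) + n)) :
    G Q N j =O[𝓝 0] fun x => ‖x‖ ^ n := by
  obtain ⟨K, hK0, hK⟩ := eval_bound N _ hN
  refine IsBigO.of_bound (K / c ^ (j + 1)) ?_
  filter_upwards [hlow, ev_norm_le] with x hx hx1
  by_cases hx0 : x = 0
  · rw [hx0, G, hQ0]
    simp
    positivity
  · have hn : 0 < ‖x‖ := norm_pos_iff.2 hx0
    have h1 : 0 < c * ‖x‖ ^ m := by positivity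
    have h2 : (c * ‖x‖ ^ m) ^ (j + 1) ≤ eval x Q ^ (j + 1) := by gcongr
    rw [G, norm_div, norm_pow, norm_pow, norm_norm, Real.norm_eq_abs, Real.norm_eq_abs,
      abs_of_pos (h1.trans_le hx)]
    calc |eval x N| / eval x Q ^ (j + 1) ≤ K * ‖x‖ ^ (m * (j + 1) + n) / (c * ‖x‖ ^ m) ^ (j + 1) := by
          gcongr
          exact hK x hx1
      _ = K / c ^ (j + 1) * ‖x‖ ^ n := by
          rw [mul_pow, ← pow_mul, pow_add]
          field_simp

lemma ev_ne (Q : P2) (m : ℕ) (c : ℝ) (hc : 0 < c)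
    (hlow : ∀ᶠ x : E2 in 𝓝 0, c * ‖x‖ ^ m ≤ eval x Q) :
    ∀ᶠ x : E2 in 𝓝 0, x ≠ 0 → eval x Q ≠ 0 := by
  filter_upwards [hlow] with x hx hx0
  have hn : 0 < ‖x‖ := norm_pos_iff.2 hx0
  exact ((by positivity : 0 < c * ‖x‖ ^ m).trans_le hx).ne'

/-- continuity criterion -/
lemma cont_crit (Q N : P2) (j m : ℕ) (c : ℝ) (hc : 0 < c) (hQ0 : eval 0 Q = 0)
    (hlow : ∀ᶠ x : E2 in 𝓝 0, c * ‖x‖ ^ m ≤ eval x Q)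
    {F : Type} [NormedAddCommGroup F] [NormedSpace ℝ F] (h : E2 → F) (hh : Continuous h)
    (h0 : Tendsto (fun x => G Q N j x • h x) (𝓝 0) (𝓝 0)) :
    ContDiffAt ℝ 0 (fun x => G Q N j x • h x) 0 := by
  rw [contDiffAt_zero]
  refine ⟨_, ev_ne Q m c hc hlow, fun x hx => ?_⟩
  by_cases hx0 : x = 0
  · subst hx0
    refine ContinuousAt.continuousWithinAt ?_
    have : G Q N j 0 • h 0 = 0 := by rw [G, hQ0]; simp
    rw [ContinuousAt, this]
    exact h0
  · exact ((G_hasFDerivAt Q N j x (hx hx0)).continuousAt.smul hh.continuousAt).continuousWithinAt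

lemma step (Q N : P2) (j m n : ℕ) (c : ℝ) (hc : 0 < c) (hQ0 : eval 0 Q = 0)
    (hlow : ∀ᶠ x : E2 in 𝓝 0, c * ‖x‖ ^ m ≤ eval x Q)
    {F : Type} [NormedAddCommGroup F] [NormedSpace ℝ F] (h : E2 → F)
    (hh : ContDiff ℝ (n + 1 : ℕ) h)
    (h0 : (fun x => G Q N j x • h x) =o[𝓝 0] fun x => x)
    (h1 : ContDiffAt ℝ n (fun x => G Q N j x • fderiv ℝ h x) 0)
    (h2 : ∀ i, ContDiffAt ℝ n (fun x => G Q (dN Q N j i) (j + 1) x • h x) 0) :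
    ContDiffAt ℝ (n + 1 : ℕ) (fun x => G Q N j x • h x) 0 := by
  have hd : Differentiable ℝ h := hh.differentiable (by simp)
  push_cast
  rw [contDiffAt_succ_iff_hasFDerivAt]
  refine ⟨fun x => G Q N j x • fderiv ℝ h x + ∑ i,
    (ContinuousLinearMap.proj (R := ℝ) (φ := fun _ : Fin 2 => ℝ) i).smulRight
      (G Q (dN Q N j i) (j + 1) x • h x), ⟨_, ev_ne Q m c hc hlow, fun x hx => ?_⟩, ?_⟩
  · by_cases hx0 : x = 0
    · subst hx0
      rw [hasFDerivAt_iff_isLittleO_nhds_zero]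
      have e : ∀ (N : P2) (j : ℕ), G Q N j 0 = 0 := fun N j => by rw [G, hQ0]; simp
      simpa [e] using h0
    · refine ((G_hasFDerivAt Q N j x (hx hx0)).smul (hd x).hasFDerivAt).congr_fderiv ?_
      ext v
      simp [Fin.sum_univ_two, add_smul, smul_smul, mul_comm]
  · refine h1.add (ContDiffAt.sum fun i _ => ?_)
    exact ((ContinuousLinearMap.smulRightL ℝ E2 F
      (ContinuousLinearMap.proj (R := ℝ) (φ := fun _ : Fin 2 => ℝ) i)).contDiff.contDiffAt).comp
      (0 : E2) (h2 i)

lemma norm_pow_isLittleO (n : ℕ) : (fun x : E2 => ‖x‖ ^ (n + 2)) =o[𝓝 0] fun x => x := by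
  have h1 : (fun x : E2 => ‖x‖ ^ (n + 1)) =o[𝓝 0] fun _ => (1 : ℝ) := by
    rw [isLittleO_one_iff]
    have : Tendsto (fun x : E2 => ‖x‖ ^ (n + 1)) (𝓝 0) (𝓝 (‖(0 : E2)‖ ^ (n + 1))) :=
      Continuous.tendsto (by fun_prop) 0
    simpa using this
  have h2 := h1.mul_isBigO (isBigO_refl (fun x : E2 => ‖x‖) (𝓝 0))
  simp only [one_mul, ← pow_succ] at h2
  exact h2.of_norm_right

lemma lemC (Q : P2) (m : ℕ) (c : ℝ) (hc : 0 < c) (hQ : Q ∈ I2 ^ m) (hQ0 : eval 0 Q = 0)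
    (hlow : ∀ᶠ x : E2 in 𝓝 0, c * ‖x‖ ^ m ≤ eval x Q) (n : ℕ) :
    ∀ {F : Type} [NormedAddCommGroup F] [NormedSpace ℝ F] (h : E2 → F) (_ : ContDiff ℝ n h)
      (N : P2) (j : ℕ) (_ : N ∈ I2 ^ (m * (j + 1) + (n + 1))),
      ContDiffAt ℝ n (fun x => G Q N j x • h x) 0 := by
  induction n with
  | zero =>
    intro F _ _ h hh N j hN
    refine cont_crit Q N j m c hc hQ0 hlow h hh.continuous ?_
    have h1 := (G_isBigO Q N j m 1 c hc hQ0 hlow hN).trans_tendsto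
      (by simpa using (continuous_norm.tendsto (0 : E2)))
    simpa using h1.smul (hh.continuous.tendsto 0)
  | succ n ih =>
    intro F _ _ h hh N j hN
    refine step Q N j m n c hc hQ0 hlow h hh ?_ ?_ ?_
    · have h1 := (G_isBigO Q N j m (n + 2) c hc hQ0 hlow hN).smul
        ((hh.continuous.tendsto 0).isBigO_one ℝ)
      simp only [smul_eq_mul, mul_one] at h1
      exact h1.trans_isLittleO (norm_pow_isLittleO n)
    · exact ih _ (hh.fderiv_right (by norm_cast)) N j (Ideal.pow_le_pow_right (by omega) hN)
    · intro i
      exact ih h (hh.of_le (by norm_cast; omega)) _ _ (dN_mem Q N j m (n + 1) i hQ hN)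

lemma lemB (Q : P2) (m : ℕ) (c : ℝ) (hc : 0 < c) (hQ : Q ∈ I2 ^ m) (hQ0 : eval 0 Q = 0)
    (hlow : ∀ᶠ x : E2 in 𝓝 0, c * ‖x‖ ^ m ≤ eval x Q) (n : ℕ) :
    ∀ {F : Type} [NormedAddCommGroup F] [NormedSpace ℝ F] (h : E2 → F) (_ : ContDiff ℝ n h)
      (_ : h 0 = 0) (N : P2) (j : ℕ) (_ : N ∈ I2 ^ (m * (j + 1) + n)),
      ContDiffAt ℝ n (fun x => G Q N j x • h x) 0 := by
  induction n with
  | zero =>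
    intro F _ _ h hh hz N j hN
    refine cont_crit Q N j m c hc hQ0 hlow h hh.continuous ?_
    have h1 := (G_isBigO Q N j m 0 c hc hQ0 hlow hN).smul (isBigO_refl h (𝓝 0))
    refine h1.trans_tendsto ?_
    simpa [hz] using hh.continuous.tendsto 0
  | succ n ih =>
    intro F _ _ h hh hz N j hN
    refine step Q N j m n c hc hQ0 hlow h hh ?_ ?_ ?_
    · have hd : Differentiable ℝ h := hh.differentiable (by simp)
      have h2 : h =O[𝓝 0] fun x => ‖x‖ := by
        have := (hd 0).hasFDerivAt.isBigO_sub
        simpa [hz] using this.norm_right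
      have h1 := (G_isBigO Q N j m (n + 1) c hc hQ0 hlow hN).smul h2
      simp only [smul_eq_mul, ← pow_succ] at h1
      exact h1.trans_isLittleO (norm_pow_isLittleO n)
    · exact lemC Q m c hc hQ hQ0 hlow n _ (hh.fderiv_right (by norm_cast)) N j hN
    · intro i
      exact ih h (hh.of_le (by norm_cast; omega)) hz _ _ (dN_mem Q N j m n i hQ hN)

end Reg

namespace Reg

open Filter Topology Asymptotics

lemma eval_shift (a y : E2) (q : P2) : eval y (shiftPoly a q) = eval (a + y) q := by
  unfold shiftPoly
  induction q using MvPolynomial.induction_on with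
  | C r => simp
  | add p q hp hq => rw [map_add, map_add, hp, hq, map_add]
  | mul_X p i hp => rw [map_mul, map_mul, hp, map_mul]; simp

lemma shift_mul (a : E2) (p q : P2) : shiftPoly a (p * q) = shiftPoly a p * shiftPoly a q := by
  simp [shiftPoly]

lemma shift_ne_zero (a : E2) (p : P2) (hp : p ≠ 0) : shiftPoly a p ≠ 0 := by
  intro h
  apply hp
  refine MvPolynomial.funext fun x => ?_
  have := eval_shift a (x - a) p
  rw [h, add_sub_cancel] at this
  rw [← this]; simp

lemma exists_order (P : P2) (hP : P ≠ 0) :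
    ∃ e : ℕ, P ∈ I2 ^ e ∧ homogeneousComponent e P ≠ 0 := by
  classical
  have hex : ∃ e, homogeneousComponent e P ≠ 0 := by
    by_contra hcon
    push Not at hcon
    apply hP
    rw [← sum_homogeneousComponent P]
    exact Finset.sum_eq_zero fun i _ => hcon i
  refine ⟨Nat.find hex, ?_, Nat.find_spec hex⟩
  rw [mem_iff_comp]
  intro d hd
  exact not_not.1 (Nat.find_min hex hd)

lemma locPosDef_all (q : P2) (hq : ∀ x : E2, 0 ≤ eval x q)
    (hl : ∀ a : E2, eval a q = 0 → LocPosDef q a) (a : E2) : LocPosDef q a := by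
  by_cases h0 : eval a q = 0
  · exact hl a h0
  · have hpos : 0 < eval a q := lt_of_le_of_ne (hq a) (Ne.symm h0)
    have e : coeff 0 (shiftPoly a q) = eval a q := by
      have := eval_shift a 0 q
      rw [add_zero] at this
      rw [← this]
      simp [constantCoeff_eq]
    refine ⟨0, ?_, by simp, fun y _ => ?_⟩
    · rw [homogeneousComponent_zero, e]
      simpa using h0
    · rw [homogeneousComponent_zero, e, eval_C]
      exact hpos

lemma locPosDef_ne_zero (q : P2) (a : E2) (h : LocPosDef q a) : q ≠ 0 := by
  rintro rfl
  obtain ⟨m, h1, -⟩ := h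
  apply h1
  simp [shiftPoly]

lemma locPosDef_factor (g r q s : P2) (a : E2) (hq : LocPosDef q a) (hs : LocPosDef s a)
    (he : g * r = q * s) (hr : ∀ x : E2, 0 ≤ eval x r) : LocPosDef r a := by
  have hne : g * r ≠ 0 := he ▸ mul_ne_zero (locPosDef_ne_zero q a hq) (locPosDef_ne_zero s a hs)
  obtain ⟨m1, hm1, hm1', hp1⟩ := hq
  obtain ⟨m2, hm2, hm2', hp2⟩ := hs
  rw [← mem_iff_comp] at hm1' hm2'
  obtain ⟨e1, he1, he1'⟩ := exists_order _ (shift_ne_zero a g (left_ne_zero_of_mul hne))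
  obtain ⟨e2, he2, he2'⟩ := exists_order _ (shift_ne_zero a r (right_ne_zero_of_mul hne))
  have hE : shiftPoly a g * shiftPoly a r = shiftPoly a q * shiftPoly a s := by
    rw [← shift_mul, ← shift_mul, he]
  have hA := comp_mul _ _ _ _ he1 he2
  have hB := comp_mul _ _ _ _ hm1' hm2'
  have hAm := Ideal.mul_mem_mul he1 he2
  have hBm := Ideal.mul_mem_mul hm1' hm2'
  rw [← pow_add, mem_iff_comp] at hAm hBm
  have hdeg : e1 + e2 = m1 + m2 := by
    apply le_antisymm
    · by_contra hlt
      have := hAm (m1 + m2) (by omega)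
      rw [hE, hB] at this
      exact mul_ne_zero hm1 hm2 this
    · by_contra hlt
      have := hBm (e1 + e2) (by omega)
      rw [← hE, hA] at this
      exact mul_ne_zero he1' he2' this
  rw [hE, hdeg, hB] at hA
  refine ⟨e2, he2', (mem_iff_comp _ _).1 he2, fun y hy => ?_⟩
  have h1 := congrArg (eval y) hA
  rw [map_mul, map_mul] at h1
  have h2 : eval y (homogeneousComponent e2 (shiftPoly a r)) ≠ 0 := by
    intro h3
    rw [h3, mul_zero] at h1
    exact (mul_pos (hp1 y hy) (hp2 y hy)).ne' h1
  refine lt_of_le_of_ne ?_ h2.symm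
  refine ge_of_tendsto (tendsto_comp _ _ he2 y) ?_
  filter_upwards [self_mem_nhdsWithin] with t ht
  have ht : 0 < t := ht
  rw [eval_shift]
  exact div_nonneg (hr _) (by positivity)

lemma const_sign (r : P2) (hr : {x : E2 | eval x r = 0}.Finite) :
    (∀ x : E2, 0 ≤ eval x r) ∨ (∀ x : E2, 0 ≤ eval x (-r)) := by
  by_contra hcon
  push Not at hcon
  obtain ⟨⟨x, hx⟩, ⟨y, hy⟩⟩ := hcon
  rw [map_neg] at hy
  have hconn := (hr.countable.isConnected_compl_of_one_lt_rank (by simp)).isPreconnected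
  have hiv := hconn.intermediate_value (a := x) (b := y) (by simpa using hx.ne)
    (by simp; linarith) (MvPolynomial.continuous_eval r).continuousOn
  obtain ⟨z, hz, hz0⟩ := hiv (⟨hx.le, by linarith⟩ : (0 : ℝ) ∈ Set.Icc _ _)
  exact hz hz0

lemma regulous_mul (f h : E2 → ℝ) (hf : OneRegulous f) (hh : OneRegulous h) :
    OneRegulous (fun x => h x * f x) := by
  obtain ⟨hfc, p, q, -, hq0, hqf, hqe, hql⟩ := hf
  obtain ⟨hhc, r, s, -, hs0, hsf, hse, hsl⟩ := hh
  refine ⟨hhc.mul hfc, ?_⟩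
  have hqL := locPosDef_all q hq0 hql
  have hsL := locPosDef_all s hs0 hsl
  have hne : q * s ≠ 0 :=
    mul_ne_zero (locPosDef_ne_zero q 0 (hqL 0)) (locPosDef_ne_zero s 0 (hsL 0))
  have hfin : {x : E2 | eval x (q * s) = 0}.Finite := by
    refine (hqf.union hsf).subset fun x hx => ?_
    simpa using hx
  suffices hmain : ∃ P R g : P2, IsRelPrime P R ∧ g * R = q * s ∧ g * P = p * r ∧
      ∀ x : E2, 0 ≤ eval x R by
    obtain ⟨P, R, g, hrel, hR, hP, hR0⟩ := hmain
    refine ⟨P, R, hrel, hR0, hfin.subset fun x hx => ?_, fun x hx => ?_,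
      fun a _ => locPosDef_factor g R q s a (hqL a) (hsL a) hR hR0⟩
    · have hx : eval x R = 0 := hx
      show eval x (q * s) = 0
      rw [← hR, map_mul, hx, mul_zero]
    · have hdense : Dense ({x : E2 | eval x (q * s) = 0}ᶜ) := hfin.countable.dense_compl ℝ
      have hfun : (fun x : E2 => (h x * f x) * eval x R) = fun x => eval x P := by
        refine Continuous.ext_on hdense
          ((hhc.mul hfc).mul (MvPolynomial.continuous_eval R)) (MvPolynomial.continuous_eval P) ?_
        intro z hz
        have hz : eval z (q * s) ≠ 0 := hz
        have hz2 := hz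
        rw [map_mul] at hz2
        have hzq := left_ne_zero_of_mul hz2
        have hzs := right_ne_zero_of_mul hz2
        have hg : eval z g ≠ 0 := by
          intro h0
          apply hz
          rw [← hR, map_mul, h0, zero_mul]
        have e1 := congrArg (eval z) hR
        have e2 := congrArg (eval z) hP
        simp only [map_mul] at e1 e2
        show (h z * f z) * eval z R = eval z P
        rw [hqe z hzq, hse z hzs]
        apply mul_left_cancel₀ hg
        rw [e2]
        calc _ = eval z r / eval z s * (eval z p / eval z q) * (eval z g * eval z R) := by ring
          _ = _ := by rw [e1]; field_simp
      have := congrFun hfun x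
      exact (eq_div_iff hx).2 this
  obtain ⟨R, P, g, hrel, hR, hP⟩ :=
    UniqueFactorizationMonoid.exists_reduced_factors (q * s) hne (p * r)
  have hRfin : {x : E2 | eval x R = 0}.Finite := by
    refine hfin.subset fun x hx => ?_
    have hx : eval x R = 0 := hx
    show eval x (q * s) = 0
    rw [← hR, map_mul, hx, mul_zero]
  rcases const_sign R hRfin with h0 | h0
  · exact ⟨P, R, g, hrel.symm, hR, hP, h0⟩
  · exact ⟨-P, -R, -g, hrel.symm.neg_neg, by rw [neg_mul_neg, hR], by rw [neg_mul_neg, hP], h0⟩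

lemma contDiffAt_pole (k : ℕ) (f h : E2 → ℝ) (hfc : ContDiff ℝ k f)
    (hhc : ContDiff ℝ (k + 1 : ℕ) h) (p q : P2)
    (hrep : ∀ x : E2, eval x q ≠ 0 → f x = eval x p / eval x q)
    (hq0 : eval 0 q = 0) (hh0 : h 0 = 0) (m : ℕ) (hm : q ∈ I2 ^ m)
    (hpos : ∀ y : E2, y ≠ 0 → 0 < eval y (homogeneousComponent m q)) :
    ContDiffAt ℝ (k + 1 : ℕ) (fun x => h x * f x) 0 := by
  obtain ⟨c, hc, hlow⟩ := lower_bound q m hm hpos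
  obtain ⟨T, hT⟩ := taylor k f hfc
  have hne := ev_ne q m c hc hlow
  set N := p - T * q with hN
  have hNmem : N ∈ I2 ^ (k + m + 1) := by
    apply mem_of_isLittleO
    have h1 := (hT.mul_isBigO (eval_isBigO q m hm)).mono (nhdsWithin_le_nhds (s := {0}ᶜ))
    refine h1.congr' ?_ ?_
    · filter_upwards [self_mem_nhdsWithin, nhdsWithin_le_nhds hne] with x hx hx2
      have hqx := hx2 hx
      rw [hrep x hqx, hN, map_sub, map_mul]
      field_simp
    · exact Eventually.of_forall fun x => (pow_add _ _ _).symm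
  have hB := lemB q m c hc hm hq0 hlow (k + 1) h hhc hh0 N 0
    (by convert hNmem using 2; ring)
  have hT' : ContDiffAt ℝ (k + 1 : ℕ) (fun x => h x * eval x T) 0 :=
    (hhc.mul (contDiff_eval T)).contDiffAt
  refine (hT'.add hB).congr_of_eventuallyEq ?_
  filter_upwards [hne] with x hx
  by_cases hx0 : x = 0
  · simp [hx0, hh0]
  · have hqx := hx hx0
    rw [hrep x hqx, G, hN, map_sub, map_mul]
    simp
    field_simp
    ring

end Reg

/-- if `f ∈ R^k_{[1]}(ℝ²)` with coprime representation `p/q`, and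
`h ∈ R^{k+1}_{[1]}(ℝ²)` vanishes on `Z(q)`, then `h·f ∈ R^{k+1}_{[1]}(ℝ²)`. -/
theorem mul_vanishing_on_poles_mem_Rk1
    (k : ℕ) (f : (Fin 2 → ℝ) → ℝ) (hfc : Continuous f)
    (p q : MvPolynomial (Fin 2) ℝ) (hrep : OneRegulousRep f p q)
    (hfk : ContDiff ℝ k f)
    (h : (Fin 2 → ℝ) → ℝ) (hh : OneRegulous h) (hhk : ContDiff ℝ (k + 1 : ℕ) h)
    (hz : ∀ x : Fin 2 → ℝ, eval x q = 0 → h x = 0) :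
    OneRegulous (fun x => h x * f x) ∧ ContDiff ℝ (k + 1 : ℕ) (fun x => h x * f x) := by
  refine ⟨Reg.regulous_mul f h ⟨hfc, p, q, hrep⟩ hh, ?_⟩
  obtain ⟨-, -, -, hqe, hql⟩ := hrep
  rw [contDiff_iff_contDiffAt]
  intro a
  by_cases hqa : eval a q = 0
  · obtain ⟨m, -, hm, hpos⟩ := hql a hqa
    rw [← Reg.mem_iff_comp] at hm
    have hta : ContDiff ℝ ((k + 1 : ℕ) : WithTop ℕ∞) (fun y : Fin 2 → ℝ => a + y) :=
      contDiff_const.add contDiff_id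
    have hta' : ContDiff ℝ (k : WithTop ℕ∞) (fun y : Fin 2 → ℝ => a + y) :=
      contDiff_const.add contDiff_id
    have key := Reg.contDiffAt_pole k (fun y => f (a + y)) (fun y => h (a + y))
      (hfk.comp hta') (hhk.comp hta) (shiftPoly a p) (shiftPoly a q)
      (fun x hx => by
        rw [Reg.eval_shift] at hx
        rw [Reg.eval_shift, Reg.eval_shift]
        exact hqe _ hx)
      (by rw [Reg.eval_shift, add_zero, hqa])
      (by rw [add_zero]; exact hz a hqa) m hm hpos
    have hsub : ContDiffAt ℝ ((k + 1 : ℕ) : WithTop ℕ∞) (fun x : Fin 2 → ℝ => x - a) a :=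
      contDiffAt_id.sub contDiffAt_const
    have key2 := ContDiffAt.comp (f := fun x : Fin 2 → ℝ => x - a) a
      (by rw [sub_self]; exact key) hsub
    simpa [Function.comp_def] using key2
  · have hne : ∀ᶠ x in nhds a, eval x q ≠ 0 :=
      (MvPolynomial.continuous_eval q).continuousAt.eventually_ne hqa
    have hf : ContDiffAt ℝ ((k + 1 : ℕ) : WithTop ℕ∞) f a := by
      refine ((Reg.contDiff_eval p).contDiffAt.div
        (Reg.contDiff_eval q).contDiffAt hqa).congr_of_eventuallyEq ?_
      filter_upwards [hne] with x hx
      exact hqe x hx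
    exact hhk.contDiffAt.mul hf
end

section
/- Let k ∈ ℕ and let f : ℝ² → ℝ be [1]-regulous. Then f is of class C^k on ℝ² (i.e., f ∈ R^k_{[1]}(ℝ²)) if and only if f has a polynomial expansion of order k at every point, namely: for every a ∈ ℝ² there exists a polynomial P ∈ ℝ[x,y] of total degree at most k with P(0) = f(a) such that the function h ↦ f(a + h) − P(h) is o(‖h‖^k) as h → 0 in ℝ². -/
open MvPolynomial

open Filter Topology Asymptotics

lemma eval_shiftPoly (a h : Fin 2 → ℝ) (q : MvPolynomial (Fin 2) ℝ) :
    eval h (shiftPoly a q) = eval (a + h) q := by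
  induction q using MvPolynomial.induction_on with
  | C r => simp [shiftPoly]
  | add p q hp hq =>
    simp only [shiftPoly, map_add] at *
    rw [hp, hq]
  | mul_X p i hp =>
    simp only [shiftPoly, map_mul] at *
    rw [hp]; simp

lemma hasFDerivAt_eval (p : MvPolynomial (Fin 2) ℝ) (x : Fin 2 → ℝ) :
    HasFDerivAt (fun x => eval x p)
      (∑ i, eval x (pderiv i p) • (ContinuousLinearMap.proj i : (Fin 2 → ℝ) →L[ℝ] ℝ)) x := by
  induction p using MvPolynomial.induction_on with
  | C r => simpa using hasFDerivAt_const r x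
  | add p q hp hq =>
    have := hp.add hq
    simp only [map_add, add_smul, Finset.sum_add_distrib] at *
    exact this
  | mul_X p i hp =>
    have := hp.mul ((ContinuousLinearMap.proj i : (Fin 2 → ℝ) →L[ℝ] ℝ).hasFDerivAt (x := x))
    simp only [map_mul, eval_X]
    refine this.congr_fderiv ?_
    ext v
    fin_cases i <;> simp [pderiv_X, Fin.sum_univ_two, Pi.single_apply] <;> ring

lemma contDiff_eval (p : MvPolynomial (Fin 2) ℝ) (n : WithTop ℕ∞) :
    ContDiff ℝ n (fun x : Fin 2 → ℝ => eval x p) := by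
  induction p using MvPolynomial.induction_on with
  | C r => simpa using contDiff_const
  | add p q hp hq => simpa using hp.add hq
  | mul_X p i hp => simpa using hp.mul (contDiff_apply ℝ ℝ i)

def OrdGe (d : ℕ) (N : MvPolynomial (Fin 2) ℝ) : Prop :=
  ∀ s : Fin 2 →₀ ℕ, s.degree < d → coeff s N = 0

lemma OrdGe.mul {d e : ℕ} {M N : MvPolynomial (Fin 2) ℝ} (hM : OrdGe d M) (hN : OrdGe e N) :
    OrdGe (d + e) (M * N) := by
  intro s hs
  rw [coeff_mul]
  refine Finset.sum_eq_zero fun x hx => ?_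
  rw [Finset.HasAntidiagonal.mem_antidiagonal] at hx
  rw [← hx, map_add] at hs
  rcases lt_or_ge x.1.degree d with h | h
  · rw [hM _ h, zero_mul]
  · rw [hN _ (by omega), mul_zero]

lemma OrdGe.sub {d : ℕ} {M N : MvPolynomial (Fin 2) ℝ} (hM : OrdGe d M) (hN : OrdGe d N) :
    OrdGe d (M - N) := by
  intro s hs
  rw [coeff_sub, hM s hs, hN s hs, sub_zero]

lemma OrdGe.mono {d e : ℕ} {N : MvPolynomial (Fin 2) ℝ} (h : e ≤ d) (hN : OrdGe d N) :
    OrdGe e N := fun s hs => hN s (by omega)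

lemma OrdGe.pderiv {d : ℕ} {N : MvPolynomial (Fin 2) ℝ} (hN : OrdGe (d + 1) N) (i : Fin 2) :
    OrdGe d (pderiv i N) := by
  intro s hs
  rw [coeff_pderiv, hN, zero_mul]
  rw [map_add, Finsupp.degree_single]
  omega

lemma abs_monomial_le (h : Fin 2 → ℝ) (s : Fin 2 →₀ ℕ) :
    |∏ i, h i ^ s i| ≤ ‖h‖ ^ s.degree := by
  rw [Finset.abs_prod, Finsupp.degree_eq_sum, ← Finset.prod_pow_eq_pow_sum]
  refine Finset.prod_le_prod (fun i _ => abs_nonneg _) fun i _ => ?_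
  rw [abs_pow]
  exact pow_le_pow_left₀ (abs_nonneg _) (norm_le_pi_norm h i) _

lemma OrdGe.isBigO {d : ℕ} {N : MvPolynomial (Fin 2) ℝ} (hN : OrdGe d N) :
    (fun h : Fin 2 → ℝ => eval h N) =O[𝓝 0] fun h => ‖h‖ ^ d := by
  simp only [eval_eq']
  refine IsBigO.fun_sum fun s hs => ?_
  have hsd : d ≤ s.degree := by
    by_contra hlt
    exact (mem_support_iff.1 hs) (hN s (by omega))
  refine IsBigO.of_bound |coeff s N| ?_
  have h1 : ∀ᶠ h : Fin 2 → ℝ in 𝓝 0, ‖h‖ < 1 := by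
    have : Tendsto (fun h : Fin 2 → ℝ => ‖h‖) (𝓝 0) (𝓝 0) := by
      simpa using (continuous_norm (E := Fin 2 → ℝ)).tendsto 0
    exact this.eventually (gt_mem_nhds one_pos)
  filter_upwards [h1] with h hh
  rw [Real.norm_eq_abs, abs_mul, norm_pow, norm_norm]
  gcongr
  exact (abs_monomial_le h s).trans (pow_le_pow_of_le_one (norm_nonneg _) hh.le hsd)

lemma OrdGe.eval_zero {d : ℕ} {N : MvPolynomial (Fin 2) ℝ} (hN : OrdGe (d + 1) N) :
    eval 0 N = 0 := by
  have h := hN 0 (by simp)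
  rw [← constantCoeff_eq] at h
  simpa using h

lemma eval_smul_of_isHomogeneous {e : ℕ} {N : MvPolynomial (Fin 2) ℝ} (hN : N.IsHomogeneous e)
    (t : ℝ) (h : Fin 2 → ℝ) : eval (t • h) N = t ^ e * eval h N := by
  rw [eval_eq', eval_eq', Finset.mul_sum]
  refine Finset.sum_congr rfl fun s hs => ?_
  have : s.degree = e := by
    by_contra hne
    exact (mem_support_iff.1 hs) (hN.coeff_eq_zero hne)
  simp only [Pi.smul_apply, smul_eq_mul, mul_pow, Finset.prod_mul_distrib,
    Finset.prod_pow_eq_pow_sum]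
  rw [← this, Finsupp.degree_eq_sum]
  ring

lemma homog_eq_zero {e : ℕ} {N : MvPolynomial (Fin 2) ℝ} (hN : N.IsHomogeneous e)
    (ho : (fun h : Fin 2 → ℝ => eval h N) =o[𝓝[≠] 0] fun h => ‖h‖ ^ e) : N = 0 := by
  have key : ∀ h : Fin 2 → ℝ, h ≠ 0 → eval h N = 0 := by
    intro h hh
    have ht : Tendsto (fun t : ℝ => t • h) (𝓝[≠] 0) (𝓝[≠] 0) := by
      refine tendsto_nhdsWithin_iff.2 ⟨?_, ?_⟩
      · have : Tendsto (fun t : ℝ => t • h) (𝓝 0) (𝓝 ((0 : ℝ) • h)) :=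
          (continuous_id.smul continuous_const).tendsto _
        rw [zero_smul] at this
        exact this.mono_left nhdsWithin_le_nhds
      · filter_upwards [self_mem_nhdsWithin] with t ht
        exact smul_ne_zero ht hh
    have h2 := ho.comp_tendsto ht
    have hn : 0 < ‖h‖ ^ e := pow_pos (norm_pos_iff.2 hh) _
    by_contra hne
    have hpos : 0 < |eval h N| := abs_pos.2 hne
    have h3 := h2.def (c := |eval h N| / ‖h‖ ^ e / 2) (by positivity)
    obtain ⟨t, ht1, ht2⟩ := (h3.and self_mem_nhdsWithin).exists
    have ht0 : t ≠ 0 := ht2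
    simp only [Function.comp, eval_smul_of_isHomogeneous hN, norm_smul, Real.norm_eq_abs,
      abs_mul, abs_pow, mul_pow, abs_norm, abs_abs] at ht1
    have htp : 0 < |t| ^ e := pow_pos (abs_pos.2 ht0) _
    have : |eval h N| / ‖h‖ ^ e / 2 * (|t| ^ e * ‖h‖ ^ e) = |t| ^ e * |eval h N| / 2 := by
      field_simp
    rw [this] at ht1
    nlinarith [mul_pos htp hpos]
  refine MvPolynomial.funext fun x => ?_
  have : (fun x : Fin 2 → ℝ => eval x N) = fun x => eval x 0 := by
    refine Continuous.ext_on (dense_compl_singleton (0 : Fin 2 → ℝ))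
      (contDiff_eval N 0).continuous (contDiff_eval 0 0).continuous ?_
    intro h hh
    simpa using key h hh
  exact congrFun this x

lemma ordGe_of_isLittleO {d : ℕ} {N : MvPolynomial (Fin 2) ℝ}
    (ho : (fun h : Fin 2 → ℝ => eval h N) =o[𝓝[≠] 0] fun h => ‖h‖ ^ d) :
    ∀ e ≤ d + 1, OrdGe e N := by
  intro e
  induction e with
  | zero => intro _ s hs; omega
  | succ e ih =>
    intro he
    have hN := ih (by omega)
    have hR : OrdGe (e + 1) (N - homogeneousComponent e N) := by
      intro s hs
      rw [coeff_sub, coeff_homogeneousComponent]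
      split_ifs with hse
      · simp
      · rw [hN s (by omega)]; simp
    have hRo : (fun h : Fin 2 → ℝ => eval h (N - homogeneousComponent e N)) =o[𝓝[≠] 0]
        fun h => ‖h‖ ^ e := by
      refine (hR.isBigO.mono nhdsWithin_le_nhds).trans_isLittleO ?_
      exact (isLittleO_norm_pow_norm_pow (Nat.lt_succ_self e)).mono nhdsWithin_le_nhds
    have hNo : (fun h : Fin 2 → ℝ => eval h N) =o[𝓝[≠] 0] fun h => ‖h‖ ^ e := by
      rcases (show e = d ∨ e < d by omega) with rfl | h
      · exact ho
      · exact ho.trans ((isLittleO_norm_pow_norm_pow h).mono nhdsWithin_le_nhds)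
    have hz : homogeneousComponent e N = 0 := by
      refine homog_eq_zero (homogeneousComponent_isHomogeneous e N) ?_
      refine (hNo.sub hRo).congr_left fun h => ?_
      simp
    rw [hz, sub_zero] at hR
    exact hR

/-- lower bound near zero -/
def LowBd (m : ℕ) (q : MvPolynomial (Fin 2) ℝ) : Prop :=
  ∃ c > 0, ∀ᶠ h : Fin 2 → ℝ in 𝓝 0, c * ‖h‖ ^ m ≤ eval h q

lemma LowBd.ne {m : ℕ} {q : MvPolynomial (Fin 2) ℝ} (h : LowBd m q) :
    ∀ᶠ h : Fin 2 → ℝ in 𝓝 0, h ≠ 0 → 0 < eval h q := by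
  obtain ⟨c, hc, h⟩ := h
  filter_upwards [h] with x hx hx0
  exact lt_of_lt_of_le (mul_pos hc (pow_pos (norm_pos_iff.2 hx0) _)) hx

lemma div_isBigO {m k : ℕ} {N q : MvPolynomial (Fin 2) ℝ} (hN : OrdGe (k + m + 1) N)
    (hq : LowBd m q) :
    (fun h : Fin 2 → ℝ => eval h N / eval h q) =O[𝓝 0] fun h => ‖h‖ ^ (k + 1) := by
  obtain ⟨c, hc, h⟩ := hq
  obtain ⟨D, hD⟩ := hN.isBigO.bound
  refine IsBigO.of_bound (D / c) ?_
  filter_upwards [h, hD] with x hx hxD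
  rw [norm_div, norm_pow, norm_norm]
  rw [norm_pow, norm_norm] at hxD
  rcases eq_or_ne x 0 with rfl | hx0
  · rw [hN.eval_zero]; simp
  · have hn : 0 < ‖x‖ := norm_pos_iff.2 hx0
    have hp : 0 < c * ‖x‖ ^ m := by positivity
    have hq : c * ‖x‖ ^ m ≤ ‖eval x q‖ := hx.trans (le_abs_self _)
    rw [div_le_iff₀ (hp.trans_le hq)]
    have hD0 : 0 ≤ D := by
      by_contra hneg
      have := (norm_nonneg _).trans hxD
      have h2 : 0 < ‖x‖ ^ (k + m + 1) := by positivity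
      nlinarith
    calc ‖eval x N‖ ≤ D * ‖x‖ ^ (k + m + 1) := hxD
      _ = D / c * ‖x‖ ^ (k + 1) * (c * ‖x‖ ^ m) := by field_simp; ring
      _ ≤ _ := by gcongr

lemma contDiffAt_div (k : ℕ) : ∀ (m : ℕ) (N q : MvPolynomial (Fin 2) ℝ),
    OrdGe (k + m + 1) N → OrdGe m q → LowBd m q →
    ContDiffAt ℝ k (fun h : Fin 2 → ℝ => eval h N / eval h q) 0 := by
  induction k with
  | zero =>
    intro m N q hN hq hl
    refine contDiffAt_zero.2 ⟨_, hl.ne, ?_⟩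
    intro x hx
    refine ContinuousAt.continuousWithinAt ?_
    rcases eq_or_ne x 0 with rfl | hx0
    · have h1 := (div_isBigO hN hl).trans_tendsto (by
        have := (continuous_norm (E := Fin 2 → ℝ)).pow (0 + 1) |>.tendsto 0
        simpa using this)
      unfold ContinuousAt
      simpa only [hN.eval_zero, zero_div] using h1
    · exact (contDiff_eval N 0).continuous.continuousAt.div
        (contDiff_eval q 0).continuous.continuousAt (hx hx0).ne'
  | succ k ih =>
    intro m N q hN hq hl
    let M : Fin 2 → MvPolynomial (Fin 2) ℝ := fun i => pderiv i N * q - N * pderiv i q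
    have hM : ∀ i, OrdGe (k + (m + m) + 1) (M i) := by
      intro i
      refine OrdGe.sub ?_ ?_
      · have h1 : OrdGe (k + m + 1) (pderiv i N) :=
          OrdGe.pderiv (hN.mono (by omega)) i
        exact (h1.mul hq).mono (by omega)
      · rcases m with _ | m
        · have h0 : OrdGe 0 (pderiv i q) := fun s hs => by omega
          exact (hN.mul h0).mono (by omega)
        · exact (hN.mul (hq.pderiv i)).mono (by omega)
    have hq2 : OrdGe (m + m) (q * q) := hq.mul hq
    have hl2 : LowBd (m + m) (q * q) := by
      obtain ⟨c, hc, h⟩ := hl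
      refine ⟨c * c, by positivity, ?_⟩
      filter_upwards [h] with x hx
      rw [map_mul, pow_add]
      calc c * c * (‖x‖ ^ m * ‖x‖ ^ m) = (c * ‖x‖ ^ m) * (c * ‖x‖ ^ m) := by ring
        _ ≤ _ := mul_le_mul hx hx (by positivity) (le_trans (by positivity) hx)
    have hcd := fun i => ih (m + m) (M i) (q * q) (hM i) hq2 hl2
    have hgoal : ContDiffAt ℝ ((k : ℕ) + 1) (fun h : Fin 2 → ℝ => eval h N / eval h q) 0 := by
      refine contDiffAt_succ_iff_hasFDerivAt.2 ⟨fun x => ∑ i, (eval x (M i) / eval x (q * q)) •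
        (ContinuousLinearMap.proj i : (Fin 2 → ℝ) →L[ℝ] ℝ), ⟨_, hl.ne, ?_⟩, ?_⟩
      · intro x hx
        rcases eq_or_ne x 0 with rfl | hx0
        · have h0 : ∀ i, eval 0 (M i) = 0 := fun i => (hM i).eval_zero
          simp only [h0, zero_div, zero_smul, Finset.sum_const_zero]
          rw [hasFDerivAt_iff_isLittleO_nhds_zero]
          simp only [zero_add, hN.eval_zero, zero_div, sub_zero, _root_.zero_apply]
          refine (div_isBigO hN hl).trans_isLittleO ?_
          have : (fun h : Fin 2 → ℝ => ‖h‖ ^ (k + 1 + 1)) =o[𝓝 0] fun h => ‖h‖ ^ 1 :=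
            isLittleO_norm_pow_norm_pow (by omega)
          simp only [pow_one] at this
          exact this.of_norm_right
        · have hqx := (hx hx0).ne'
          have := (hasFDerivAt_eval N x).mul
            ((hasDerivAt_inv hqx).comp_hasFDerivAt x (hasFDerivAt_eval q x))
          simp only [div_eq_mul_inv]
          refine this.congr_fderiv ?_
          ext v
          simp [M, Fin.sum_univ_two]
          field_simp
          ring
      · refine ContDiffAt.sum fun i _ => ?_
        exact (hcd i).smul contDiffAt_const
    exact_mod_cast hgoal

lemma lowBd_of_posDef {m : ℕ} {q : MvPolynomial (Fin 2) ℝ} (hq : OrdGe m q)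
    (hpos : ∀ y : Fin 2 → ℝ, y ≠ 0 → 0 < eval y (homogeneousComponent m q)) : LowBd m q := by
  set Q := homogeneousComponent m q with hQ
  have hR : OrdGe (m + 1) (q - Q) := by
    intro s hs
    rw [coeff_sub, hQ, coeff_homogeneousComponent]
    split_ifs with hse
    · simp
    · rw [hq s (by omega)]; simp
  obtain ⟨y₀, hy₀, hmin⟩ := (isCompact_sphere (0 : Fin 2 → ℝ) 1).exists_isMinOn
    (NormedSpace.sphere_nonempty.2 zero_le_one) (contDiff_eval Q 0).continuous.continuousOn
  have hy0 : y₀ ≠ 0 := by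
    rintro rfl
    simp at hy₀
  set c := eval y₀ Q with hc
  have hcpos : 0 < c := hpos y₀ hy0
  have hlow : ∀ h : Fin 2 → ℝ, h ≠ 0 → c * ‖h‖ ^ m ≤ eval h Q := by
    intro h hh
    have hn : 0 < ‖h‖ := norm_pos_iff.2 hh
    have h1 : c ≤ eval (‖h‖⁻¹ • h) Q := hmin (by
      simp [norm_smul, hn.ne'])
    have h2 := eval_smul_of_isHomogeneous (homogeneousComponent_isHomogeneous m q) ‖h‖
      (‖h‖⁻¹ • h)
    rw [smul_inv_smul₀ hn.ne'] at h2
    rw [← hQ] at h2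
    rw [h2, mul_comm]
    gcongr
  have hRo : (fun h : Fin 2 → ℝ => eval h (q - Q)) =o[𝓝 0] fun h => ‖h‖ ^ m :=
    hR.isBigO.trans_isLittleO (isLittleO_norm_pow_norm_pow (Nat.lt_succ_self m))
  have hcont : ∀ᶠ h : Fin 2 → ℝ in 𝓝 0, h ≠ 0 → c / 2 * ‖h‖ ^ m ≤ eval h q := by
    filter_upwards [hRo.def (half_pos hcpos)] with h hh h0
    rw [norm_pow, norm_norm, map_sub, Real.norm_eq_abs] at hh
    have := hlow h h0
    have := (abs_le.1 hh).1
    linarith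
  refine ⟨c / 2, half_pos hcpos, ?_⟩
  have h0 : c / 2 * ‖(0 : Fin 2 → ℝ)‖ ^ m ≤ eval (0 : Fin 2 → ℝ) q := by
    have hne : (𝓝[≠] (0 : Fin 2 → ℝ)).NeBot := inferInstance
    refine le_of_tendsto_of_tendsto (b := 𝓝[≠] (0 : Fin 2 → ℝ))
      (f := fun h => c / 2 * ‖h‖ ^ m) (g := fun h => eval h q) ?_ ?_ ?_
    · have : Continuous fun h : Fin 2 → ℝ => c / 2 * ‖h‖ ^ m := by fun_prop
      exact (this.tendsto 0).mono_left nhdsWithin_le_nhds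
    · exact ((contDiff_eval q 0).continuous.tendsto 0).mono_left nhdsWithin_le_nhds
    · filter_upwards [hcont.filter_mono nhdsWithin_le_nhds, self_mem_nhdsWithin] with h hh hh0
      exact hh hh0
  filter_upwards [hcont] with h hh
  rcases eq_or_ne h 0 with rfl | hne
  · exact h0
  · exact hh hne

lemma exists_antideriv (k : ℕ) (P : MvPolynomial (Fin 2) ℝ) (hP : P.totalDegree ≤ k) :
    ∃ Q : MvPolynomial (Fin 2) ℝ, Q.totalDegree ≤ k ∧ ∀ (h : Fin 2 → ℝ) (t : ℝ),
      HasDerivAt (fun t : ℝ => t * eval (t • h) Q) (eval (t • h) P) t := by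
  refine ⟨∑ j ∈ Finset.range (k + 1), C ((j : ℝ) + 1)⁻¹ * homogeneousComponent j P, ?_, ?_⟩
  · refine totalDegree_finsetSum_le fun j hj => ?_
    refine (totalDegree_mul _ _).trans ?_
    rw [totalDegree_C, zero_add]
    have := (homogeneousComponent_isHomogeneous j P).totalDegree_le
    have := Finset.mem_range.1 hj
    omega
  · intro h t
    have hPs : P = ∑ j ∈ Finset.range (k + 1), homogeneousComponent j P := by
      conv_lhs => rw [← sum_homogeneousComponent P]
      refine Finset.sum_subset (Finset.range_subset_range.2 (by omega)) fun j _ hj => ?_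
      refine homogeneousComponent_eq_zero _ _ ?_
      rw [Finset.mem_range] at hj
      omega
    have e1 : (fun t : ℝ => t * eval (t • h) (∑ j ∈ Finset.range (k + 1),
        C ((j : ℝ) + 1)⁻¹ * homogeneousComponent j P)) = fun t => ∑ j ∈ Finset.range (k + 1),
        ((j : ℝ) + 1)⁻¹ * eval h (homogeneousComponent j P) * t ^ (j + 1) := by
      funext t
      rw [map_sum, Finset.mul_sum]
      refine Finset.sum_congr rfl fun j _ => ?_
      rw [map_mul, eval_C, eval_smul_of_isHomogeneous (homogeneousComponent_isHomogeneous j P)]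
      ring
    have e2 : eval (t • h) P = ∑ j ∈ Finset.range (k + 1),
        ((j : ℝ) + 1)⁻¹ * eval h (homogeneousComponent j P) * (((j + 1 : ℕ) : ℝ) * t ^ j) := by
      conv_lhs => rw [hPs]
      rw [map_sum]
      refine Finset.sum_congr rfl fun j _ => ?_
      rw [eval_smul_of_isHomogeneous (homogeneousComponent_isHomogeneous j P)]
      have : (j : ℝ) + 1 ≠ 0 := by positivity
      push_cast
      field_simp
    rw [e1, e2]
    refine HasDerivAt.fun_sum fun j _ => ?_
    have := (hasDerivAt_pow (j + 1) t).const_mul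
      (((j : ℝ) + 1)⁻¹ * eval h (homogeneousComponent j P))
    simpa using this

lemma taylor_exists (k : ℕ) : ∀ (f : (Fin 2 → ℝ) → ℝ), ContDiff ℝ k f → ∀ a : Fin 2 → ℝ,
    ∃ P : MvPolynomial (Fin 2) ℝ, P.totalDegree ≤ k ∧ eval (0 : Fin 2 → ℝ) P = f a ∧
      (fun h => f (a + h) - eval h P) =o[𝓝 (0 : Fin 2 → ℝ)] (fun h => ‖h‖ ^ k) := by
  induction k with
  | zero =>
    intro f hf a
    refine ⟨C (f a), by simp, by simp, ?_⟩
    simp only [eval_C, pow_zero]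
    rw [isLittleO_one_iff]
    have : Continuous fun h => f (a + h) - f a :=
      (hf.continuous.comp (continuous_const.add continuous_id)).sub continuous_const
    simpa using this.tendsto 0
  | succ k ih =>
    intro f hf a
    have hf' : ContDiff ℝ ((k : WithTop ℕ∞) + 1) f := by exact_mod_cast hf
    have hdiff : Differentiable ℝ f := hf'.differentiable (by simp)
    have hfd : ContDiff ℝ k (fderiv ℝ f) := (contDiff_succ_iff_fderiv.1 hf').2.2
    have hpart : ∀ i : Fin 2, ContDiff ℝ k fun x => fderiv ℝ f x (Pi.single i 1) :=
      fun i => hfd.clm_apply contDiff_const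
    choose P hPd hP0 hPo using fun i => ih _ (hpart i) a
    choose Q hQd hQ using fun i => exists_antideriv k (P i) (hPd i)
    refine ⟨C (f a) + ∑ i, X i * Q i, ?_, by simp, ?_⟩
    · refine (totalDegree_add _ _).trans (max_le (by simp) ?_)
      refine totalDegree_finsetSum_le fun i _ => ?_
      refine (totalDegree_mul _ _).trans ?_
      have := hQd i
      rw [totalDegree_X]
      omega
    · refine IsLittleO.of_bound fun ε hε => ?_
      have hev : ∀ᶠ h : Fin 2 → ℝ in 𝓝 0, ∀ i, ‖fderiv ℝ f (a + h) (Pi.single i 1) -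
          eval h (P i)‖ ≤ ε / 2 * ‖h‖ ^ k := by
        rw [eventually_all]
        intro i
        filter_upwards [(hPo i).def (half_pos hε)] with h hh
        simpa using hh
      obtain ⟨r, hr, hball⟩ := Metric.eventually_nhds_iff_ball.1 hev
      filter_upwards [Metric.ball_mem_nhds (0 : Fin 2 → ℝ) hr] with h hh
      have hderiv : ∀ t : ℝ, HasDerivAt
          (fun t : ℝ => f (a + t • h) - ∑ i, h i * (t * eval (t • h) (Q i)))
          (fderiv ℝ f (a + t • h) h - ∑ i, h i * eval (t • h) (P i)) t := by
        intro t
        refine HasDerivAt.fun_sub ?_ ?_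
        · have h1 : HasDerivAt (fun t : ℝ => a + t • h) h t := by
            simpa using ((hasDerivAt_id t).smul_const h).const_add a
          exact (hdiff _).hasFDerivAt.comp_hasDerivAt t h1
        · exact HasDerivAt.fun_sum fun i _ => (hQ i h t).const_mul (h i)
      have hbound : ∀ t ∈ Set.Ico (0 : ℝ) 1,
          ‖fderiv ℝ f (a + t • h) h - ∑ i, h i * eval (t • h) (P i)‖ ≤ ε * ‖h‖ ^ (k + 1) := by
        intro t ht
        have hle : ‖t • h‖ ≤ ‖h‖ := by
          rw [norm_smul, Real.norm_eq_abs, abs_of_nonneg ht.1]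
          exact mul_le_of_le_one_left (norm_nonneg _) ht.2.le
        have hmem : t • h ∈ Metric.ball (0 : Fin 2 → ℝ) r := by
          rw [mem_ball_zero_iff] at hh ⊢
          exact hle.trans_lt hh
        have hb := hball _ hmem
        have hsum : fderiv ℝ f (a + t • h) h = ∑ i, h i * fderiv ℝ f (a + t • h) (Pi.single i 1) := by
          generalize fderiv ℝ f (a + t • h) = L
          conv_lhs => rw [pi_eq_sum_univ' h]
          rw [map_sum]
          refine Finset.sum_congr rfl fun i _ => ?_
          rw [map_smul, smul_eq_mul]
          try congr 2
        rw [hsum, ← Finset.sum_sub_distrib]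
        refine (norm_sum_le _ _).trans ?_
        have : ∀ i ∈ (Finset.univ : Finset (Fin 2)),
            ‖h i * fderiv ℝ f (a + t • h) (Pi.single i 1) - h i * eval (t • h) (P i)‖ ≤
            ‖h‖ * (ε / 2 * ‖h‖ ^ k) := by
          intro i _
          rw [← mul_sub, norm_mul]
          refine mul_le_mul (norm_le_pi_norm h i) ((hb i).trans ?_) (norm_nonneg _) (norm_nonneg _)
          gcongr
        refine (Finset.sum_le_sum this).trans (le_of_eq ?_)
        simp
        ring
      have := norm_image_sub_le_of_norm_deriv_le_segment_01'
        (fun t _ => (hderiv t).hasDerivWithinAt) hbound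
      simp only [one_smul, zero_smul, zero_mul, mul_zero, one_mul, Finset.sum_const_zero,
        add_zero, sub_zero] at this
      rw [norm_pow, norm_norm]
      refine le_trans (le_of_eq ?_) this
      congr 1
      simp
      ring

/-- a [1]-regulous function is of class `C^k` on `ℝ²` if and only if it has a
polynomial expansion of order `k` at every point. -/
theorem oneRegulous_Ck_iff_polynomial_expansion
    (k : ℕ) (f : (Fin 2 → ℝ) → ℝ) (hf : OneRegulous f) :
    ContDiff ℝ k f ↔ ∀ a : Fin 2 → ℝ, ∃ P : MvPolynomial (Fin 2) ℝ,
      P.totalDegree ≤ k ∧ eval (0 : Fin 2 → ℝ) P = f a ∧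
      Asymptotics.IsLittleO (nhds (0 : Fin 2 → ℝ))
        (fun h => f (a + h) - eval h P) (fun h => ‖h‖ ^ k) := by
  constructor
  · intro h a
    exact taylor_exists k f h a
  · intro hexp
    obtain ⟨-, p, q, -, -, -, hfpq, hpd⟩ := hf
    refine contDiff_iff_contDiffAt.2 fun a => ?_
    by_cases hqa : eval a q = 0
    · obtain ⟨m, -, hlow, hpos⟩ := hpd a hqa
      obtain ⟨P, -, hP0, hPo⟩ := hexp a
      set q' := shiftPoly a q with hq'
      have hord : OrdGe m q' := by
        intro s hs
        have := congrArg (coeff s) (hlow _ hs)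
        simpa [coeff_homogeneousComponent] using this
      have hlb : LowBd m q' := lowBd_of_posDef hord hpos
      set N := shiftPoly a p - P * q' with hN
      have hrel : ∀ᶠ h : Fin 2 → ℝ in 𝓝 0, h ≠ 0 →
          eval h q' ≠ 0 ∧ f (a + h) = eval h (shiftPoly a p) / eval h q' := by
        filter_upwards [hlb.ne] with h hh h0
        have h1 := (hh h0).ne'
        refine ⟨h1, ?_⟩
        rw [hq', eval_shiftPoly] at h1
        rw [hq', eval_shiftPoly, eval_shiftPoly]
        exact hfpq _ h1
      have hNo : (fun h : Fin 2 → ℝ => eval h N) =o[𝓝[≠] 0] fun h => ‖h‖ ^ (k + m) := by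
        have h1 := (hPo.mul_isBigO hord.isBigO).mono (nhdsWithin_le_nhds (s := {0}ᶜ))
        simp only [← pow_add] at h1
        refine h1.congr' ?_ EventuallyEq.rfl
        filter_upwards [hrel.filter_mono nhdsWithin_le_nhds, self_mem_nhdsWithin] with h hh h0
        obtain ⟨h2, h3⟩ := hh h0
        rw [h3, hN, map_sub, map_mul]
        field_simp
      have hNord := ordGe_of_isLittleO hNo (k + m + 1) le_rfl
      have hcd := (contDiff_eval P k).contDiffAt.add (contDiffAt_div k m N q' hNord hord hlb)
      have hcd2 : ContDiffAt ℝ k (fun h => f (a + h)) 0 := by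
        refine hcd.congr_of_eventuallyEq ?_
        filter_upwards [hrel] with h hh
        rcases eq_or_ne h 0 with rfl | h0
        · rw [hNord.eval_zero, hP0, zero_div, add_zero, add_zero]
        · obtain ⟨h2, h3⟩ := hh h0
          rw [h3, hN, map_sub, map_mul]
          field_simp
          ring
      have hsub : ContDiffAt ℝ k (fun x : Fin 2 → ℝ => x - a) a :=
        contDiffAt_id.sub contDiffAt_const
      have hcomp : ContDiffAt ℝ k ((fun h => f (a + h)) ∘ fun x : Fin 2 → ℝ => x - a) a :=
        ContDiffAt.comp a (by simpa using hcd2) hsub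
      have heq : ((fun h => f (a + h)) ∘ fun x : Fin 2 → ℝ => x - a) = f := by
        funext x
        simp
      rwa [heq] at hcomp
    · have hc : ContDiffAt ℝ k (fun x => eval x p / eval x q) a :=
        (contDiff_eval p k).contDiffAt.div (contDiff_eval q k).contDiffAt hqa
      refine hc.congr_of_eventuallyEq ?_
      filter_upwards [(contDiff_eval q 0).continuous.continuousAt.eventually_ne hqa] with x hx
      exact hfpq x hx
end

section
/- For every k ∈ ℕ and every [1]-regulous function f : ℝ² → ℝ, there exists g ∈ R^k_{[1]}(ℝ²) such that g⁻¹(0) = f⁻¹(0). (Consequently, for every l ≥ 1 the topology on ℝ² generated by zero sets of functions in R^k_{[l]} does not depend on k.) -/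
open MvPolynomial

open Topology Asymptotics Filter

local notation "𝔪" => idealOfVars (Fin 2) ℝ

theorem ev_isBigO (n : ℕ) : ∀ u ∈ 𝔪 ^ n,
    (fun y : Fin 2 → ℝ => eval y u) =O[𝓝 0] fun y => ‖y‖ ^ n := by
  induction n with
  | zero =>
    intro u _
    simpa using ((continuous_eval u).tendsto 0).isBigO_one ℝ
  | succ n ih =>
    intro u hu
    rw [pow_succ'] at hu
    refine Submodule.mul_induction_on hu ?_ ?_
    · intro a ha b hb
      have h1 : (fun y : Fin 2 → ℝ => eval y a) =O[𝓝 0] fun y => ‖y‖ := by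
        refine Submodule.span_induction (p := fun a _ =>
          (fun y : Fin 2 → ℝ => eval y a) =O[𝓝 0] fun y => ‖y‖) ?_ ?_ ?_ ?_ ha
        · rintro _ ⟨i, rfl⟩
          refine IsBigO.of_bound 1 (Eventually.of_forall fun y => ?_)
          simpa using norm_le_pi_norm y i
        · simpa using isBigO_zero _ _
        · intro x y _ _ hx hy
          simpa using hx.add hy
        · intro r x _ hx
          have := (((continuous_eval r).tendsto 0).isBigO_one ℝ).mul hx
          simpa using this
      have := h1.mul (ih b hb)
      simpa [pow_succ'] using this
    · intro x y hx hy
      simpa using hx.add hy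

theorem pderiv_mem (n : ℕ) (i : Fin 2) (u : MvPolynomial (Fin 2) ℝ) (hu : u ∈ 𝔪 ^ (n + 1)) :
    pderiv i u ∈ 𝔪 ^ n := by
  induction n generalizing u with
  | zero => simp
  | succ n ih =>
    rw [pow_succ'] at hu
    refine Submodule.mul_induction_on hu ?_ ?_
    · intro a ha b hb
      rw [Derivation.leibniz]
      refine Ideal.add_mem _ ?_ ?_
      · rw [smul_eq_mul, pow_succ']
        exact Ideal.mul_mem_mul ha (ih b hb)
      · rw [smul_eq_mul]
        exact Ideal.mul_mem_right _ _ hb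
    · intro x y hx hy
      rw [map_add]
      exact Ideal.add_mem _ hx hy

/-- The differential of a polynomial. -/
noncomputable def dEv (u : MvPolynomial (Fin 2) ℝ) (y : Fin 2 → ℝ) : (Fin 2 → ℝ) →L[ℝ] ℝ :=
  ∑ i, eval y (pderiv i u) • ContinuousLinearMap.proj (R := ℝ) (φ := fun _ : Fin 2 => ℝ) i

theorem hasFDerivAt_ev (u : MvPolynomial (Fin 2) ℝ) (y : Fin 2 → ℝ) :
    HasFDerivAt (fun y : Fin 2 → ℝ => eval y u) (dEv u y) y := by
  induction u using MvPolynomial.induction_on with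
  | C a => simpa [dEv] using hasFDerivAt_const a y
  | add p q hp hq =>
    have := hp.add hq
    have e : dEv (p + q) y = dEv p y + dEv q y := by
      simp only [dEv, map_add, add_smul, Finset.sum_add_distrib]
    rw [e]
    refine this.congr_of_eventuallyEq (Eventually.of_forall fun z => ?_)
    simp
  | mul_X p i hp =>
    have h2 : HasFDerivAt (fun y : Fin 2 → ℝ => y i)
      (ContinuousLinearMap.proj (R := ℝ) (φ := fun _ : Fin 2 => ℝ) i) y := hasFDerivAt_apply i y
    have := hp.mul h2
    have e : dEv (p * X i) y = eval y p •
        ContinuousLinearMap.proj (R := ℝ) (φ := fun _ : Fin 2 => ℝ) i + y i • dEv p y := by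
      ext v
      fin_cases i <;> simp [dEv, pderiv_X, Pi.single_apply] <;> ring
    rw [e]
    refine this.congr_of_eventuallyEq (Eventually.of_forall fun z => ?_)
    simp

theorem contDiff_ev (u : MvPolynomial (Fin 2) ℝ) (n : WithTop ℕ∞) :
    ContDiff ℝ n (fun y : Fin 2 → ℝ => eval y u) := by
  induction u using MvPolynomial.induction_on with
  | C a => simpa using contDiff_const
  | add p q hp hq => simpa using hp.add hq
  | mul_X p i hp => simpa using hp.mul (contDiff_apply ℝ ℝ i)

theorem quot_isBigO {d e : ℕ} {u D : MvPolynomial (Fin 2) ℝ} {c : ℝ} {U : Set (Fin 2 → ℝ)}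
    (hU : U ∈ 𝓝 0) (hc : 0 < c) (he : 1 ≤ e) (hu : u ∈ 𝔪 ^ (d + e))
    (hD : ∀ y ∈ U, c * ‖y‖ ^ d ≤ |eval y D|) :
    (fun y : Fin 2 → ℝ => eval y u / eval y D) =O[𝓝 0] fun y => ‖y‖ ^ e := by
  obtain ⟨K, hK0, hK⟩ := (ev_isBigO _ u hu).exists_pos
  refine IsBigO.of_bound (K / c) ?_
  filter_upwards [hK.bound, hU] with y h1 h2
  have h3 := hD y h2
  simp only [norm_pow, norm_norm, norm_div] at h1 ⊢
  rw [Real.norm_eq_abs] at h1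
  rw [Real.norm_eq_abs, Real.norm_eq_abs]
  by_cases hy : y = 0
  · subst hy
    have h4 : |eval (0 : Fin 2 → ℝ) u| ≤ 0 := by
      refine h1.trans ?_
      rw [norm_zero, zero_pow (by omega), mul_zero]
    have : |eval (0 : Fin 2 → ℝ) u| = 0 := le_antisymm h4 (abs_nonneg _)
    rw [this]; simp [show e ≠ 0 by omega]
  · have hy' : 0 < ‖y‖ := norm_pos_iff.2 hy
    have h5 : 0 < c * ‖y‖ ^ d := by positivity
    rw [div_le_iff₀ (h5.trans_le h3)]
    calc _ ≤ K * ‖y‖ ^ (d + e) := h1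
      _ = K / c * ‖y‖ ^ e * (c * ‖y‖ ^ d) := by field_simp; ring
      _ ≤ _ := by gcongr

theorem quot_contDiffOn (k : ℕ) : ∀ {d : ℕ} {u D : MvPolynomial (Fin 2) ℝ} {c : ℝ}
    {U : Set (Fin 2 → ℝ)} (_ : IsOpen U) (_ : (0 : Fin 2 → ℝ) ∈ U) (_ : 0 < c)
    (_ : u ∈ 𝔪 ^ (d + k + 1)) (_ : D ∈ 𝔪 ^ d)
    (_ : ∀ y ∈ U, c * ‖y‖ ^ d ≤ |eval y D|),
    ContDiffOn ℝ k (fun y : Fin 2 → ℝ => eval y u / eval y D) U := by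
  have hne : ∀ {d : ℕ} {D : MvPolynomial (Fin 2) ℝ} {c : ℝ} {y : Fin 2 → ℝ}, 0 < c →
      c * ‖y‖ ^ d ≤ |eval y D| → y ≠ 0 → eval y D ≠ 0 := by
    intro d D c y hc h hy h0
    have hy' : 0 < ‖y‖ := norm_pos_iff.2 hy
    have h5 : 0 < c * ‖y‖ ^ d := by positivity
    rw [h0, abs_zero] at h
    linarith
  have hz : ∀ {n : ℕ} {u : MvPolynomial (Fin 2) ℝ}, u ∈ 𝔪 ^ (n + 1) →
      eval (0 : Fin 2 → ℝ) u = 0 := by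
    intro n u hu
    have := (ev_isBigO _ u hu).eq_zero_imp.self_of_nhds
    exact this (by simp)
  induction k with
  | zero =>
    intro d u D c U hU h0 hc hu _ hD
    rw [Nat.cast_zero, contDiffOn_zero]
    intro y hy
    refine ContinuousAt.continuousWithinAt ?_
    by_cases hy0 : y = 0
    · subst hy0
      have h := quot_isBigO (hU.mem_nhds h0) hc le_rfl hu hD
      have h2 : Tendsto (fun y : Fin 2 → ℝ => ‖y‖ ^ 1) (𝓝 0) (𝓝 0) := by
        simpa using (continuous_norm (E := Fin 2 → ℝ)).tendsto 0
      have := h.trans_tendsto h2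
      rw [ContinuousAt, hz hu, zero_div]
      exact this
    · exact (continuous_eval u).continuousAt.div (continuous_eval D).continuousAt
        (hne hc (hD y hy) hy0)
  | succ k ih =>
    intro d u D c U hU h0 hc hu hDm hD
    set N : Fin 2 → MvPolynomial (Fin 2) ℝ := fun i => D * pderiv i u - u * pderiv i D
    have hN : ∀ i, N i ∈ 𝔪 ^ (d + d + k + 1) := by
      intro i
      refine Ideal.sub_mem _ ?_ ?_
      · have h1 := pderiv_mem (d + k + 1) i u (by convert hu using 2; ring)
        have := Ideal.mul_mem_mul hDm h1
        rw [← pow_add] at this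
        convert this using 2; ring
      · rcases d with _ | d
        · refine Ideal.mul_mem_right _ _ (Ideal.pow_le_pow_right ?_ hu); omega
        · have h1 := pderiv_mem d i D hDm
          have := Ideal.mul_mem_mul hu h1
          rw [← pow_add] at this
          convert this using 2; ring
    have hDD : D * D ∈ 𝔪 ^ (d + d) := by rw [pow_add]; exact Ideal.mul_mem_mul hDm hDm
    have hDD' : ∀ y ∈ U, (c * c) * ‖y‖ ^ (d + d) ≤ |eval y (D * D)| := by
      intro y hy
      have h := hD y hy
      rw [map_mul, abs_mul]
      calc _ = (c * ‖y‖ ^ d) * (c * ‖y‖ ^ d) := by ring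
        _ ≤ _ := by gcongr
    have key := fun i => ih hU h0 (mul_pos hc hc) (hN i) hDD hDD'
    rw [Nat.cast_succ, contDiffOn_succ_iff_hasFDerivWithinAt_of_uniqueDiffOn hU.uniqueDiffOn]
    refine ⟨by simp, fun y => ∑ i, (eval y (N i) / eval y (D * D)) •
      ContinuousLinearMap.proj (R := ℝ) (φ := fun _ : Fin 2 => ℝ) i, ?_, ?_⟩
    · exact ContDiffOn.sum fun i _ => (key i).smul contDiffOn_const
    · intro y hy
      refine HasFDerivAt.hasFDerivWithinAt ?_
      by_cases hy0 : y = 0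
      · subst hy0
        have h := quot_isBigO (e := k + 2) (hU.mem_nhds h0) hc (by omega) hu hD
        have h2 : HasFDerivAt (fun y : Fin 2 → ℝ => eval y u / eval y D)
            (0 : (Fin 2 → ℝ) →L[ℝ] ℝ) 0 := by
          refine IsBigO.hasFDerivAt (n := k + 2) ?_ (by omega)
          simpa using h
        simp only [hz (hN _), zero_div, zero_smul, Finset.sum_const_zero]
        exact h2
      · have h3 := hne hc (hD y hy) hy0
        have h4 := (hasFDerivAt_ev u y).mul ((hasDerivAt_inv h3).comp_hasFDerivAt y
          (hasFDerivAt_ev D y))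
        have e : (∑ i, (eval y (N i) / eval y (D * D)) •
            ContinuousLinearMap.proj (R := ℝ) (φ := fun _ : Fin 2 => ℝ) i) =
            eval y u • (-(eval y D ^ 2)⁻¹ • dEv D y) + (eval y D)⁻¹ • dEv u y := by
          ext v
          simp [dEv, N]
          field_simp
          ring
        beta_reduce
        rw [e]
        refine h4.congr_of_eventuallyEq (Eventually.of_forall fun z => ?_)
        simp [div_eq_mul_inv]

theorem mem_pow_iff_hom (n : ℕ) (u : MvPolynomial (Fin 2) ℝ) :
    u ∈ 𝔪 ^ n ↔ ∀ d < n, homogeneousComponent d u = 0 := by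
  rw [mem_pow_idealOfVars_iff']
  constructor
  · intro h d hd
    ext s
    rw [coeff_homogeneousComponent]
    split_ifs with hs
    · simpa using h s (by omega)
    · simp
  · intro h s hs
    have := congrArg (coeff s) (h _ hs)
    simpa [coeff_homogeneousComponent] using this

theorem sub_hom_mem {n : ℕ} {u : MvPolynomial (Fin 2) ℝ} (hu : u ∈ 𝔪 ^ n) :
    u - homogeneousComponent n u ∈ 𝔪 ^ (n + 1) := by
  rw [mem_pow_idealOfVars_iff'] at hu ⊢
  intro s hs
  rw [coeff_sub, coeff_homogeneousComponent]
  split_ifs with h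
  · simp
  · rw [hu s (by omega)]; simp

theorem hom_eval_smul {n : ℕ} {u : MvPolynomial (Fin 2) ℝ} (t : ℝ) (y : Fin 2 → ℝ) :
    eval (t • y) (homogeneousComponent n u) = t ^ n * eval y (homogeneousComponent n u) := by
  rw [homogeneousComponent_apply, map_sum, map_sum, Finset.mul_sum]
  refine Finset.sum_congr rfl fun s hs => ?_
  have hd : s.degree = n := (Finset.mem_filter.1 hs).2
  have hd' : s 0 + s 1 = n := by
    rw [← hd, Finsupp.degree_eq_sum, Fin.sum_univ_two]
  rw [eval_monomial, eval_monomial, Finsupp.prod_fintype _ _ (by simp),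
    Finsupp.prod_fintype _ _ (by simp), Fin.prod_univ_two, Fin.prod_univ_two, ← hd']
  simp only [Pi.smul_apply, smul_eq_mul, mul_pow]
  ring

theorem rem_isLittleO {n : ℕ} {v : MvPolynomial (Fin 2) ℝ} (hv : v ∈ 𝔪 ^ (n + 1)) :
    (fun y : Fin 2 → ℝ => eval y v) =o[𝓝 0] fun y => ‖y‖ ^ n := by
  refine (ev_isBigO _ v hv).trans_isLittleO ?_
  have h1 : (fun y : Fin 2 → ℝ => ‖y‖) =o[𝓝 0] fun _ => (1 : ℝ) := by
    rw [isLittleO_one_iff]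
    simpa using (continuous_norm (E := Fin 2 → ℝ)).tendsto 0
  simpa [pow_succ] using (isBigO_refl (fun y : Fin 2 → ℝ => ‖y‖ ^ n) (𝓝 0)).mul_isLittleO h1

theorem tendsto_ray (y : Fin 2 → ℝ) (hy : y ≠ 0) :
    Tendsto (fun t : ℝ => t • y) (𝓝[>] 0) (𝓝[≠] 0) := by
  refine tendsto_nhdsWithin_iff.2 ⟨?_, ?_⟩
  · have : Tendsto (fun t : ℝ => t • y) (𝓝 0) (𝓝 ((0 : ℝ) • y)) :=
      (continuous_id.smul continuous_const).tendsto 0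
    rw [zero_smul] at this
    exact this.mono_left nhdsWithin_le_nhds
  · filter_upwards [self_mem_nhdsWithin] with t ht
    exact smul_ne_zero (ne_of_gt ht) hy

theorem isLittleO_ray {n : ℕ} {g : (Fin 2 → ℝ) → ℝ} (hg : g =o[𝓝[≠] 0] fun y => ‖y‖ ^ n)
    (y : Fin 2 → ℝ) (hy : y ≠ 0) :
    Tendsto (fun t : ℝ => g (t • y) / t ^ n) (𝓝[>] 0) (𝓝 0) := by
  have h := hg.comp_tendsto (tendsto_ray y hy)
  have h2 : (fun t : ℝ => g (t • y)) =o[𝓝[>] 0] fun t => t ^ n := by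
    refine h.trans_isBigO ?_
    refine IsBigO.of_bound (‖y‖ ^ n) (Eventually.of_forall fun t => ?_)
    simp [norm_smul, mul_pow, mul_comm]
  exact h2.tendsto_div_nhds_zero

theorem tendsto_hom {n : ℕ} {u : MvPolynomial (Fin 2) ℝ} (hu : u ∈ 𝔪 ^ n)
    (y : Fin 2 → ℝ) (hy : y ≠ 0) :
    Tendsto (fun t : ℝ => eval (t • y) u / t ^ n) (𝓝[>] 0)
      (𝓝 (eval y (homogeneousComponent n u))) := by
  have h := isLittleO_ray ((rem_isLittleO (sub_hom_mem hu)).mono nhdsWithin_le_nhds) y hy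
  have h2 := h.add_const (eval y (homogeneousComponent n u))
  rw [zero_add] at h2
  refine h2.congr' ?_
  filter_upwards [self_mem_nhdsWithin] with t ht
  have ht' : (t : ℝ) ≠ 0 := ne_of_gt ht
  rw [map_sub, hom_eval_smul]
  field_simp
  ring

theorem step_mem {n : ℕ} {u : MvPolynomial (Fin 2) ℝ} (hu : u ∈ 𝔪 ^ n)
    (ho : (fun y : Fin 2 → ℝ => eval y u) =o[𝓝[≠] 0] fun y => ‖y‖ ^ n) :
    u ∈ 𝔪 ^ (n + 1) := by
  have h0 : ∀ y : Fin 2 → ℝ, y ≠ 0 → eval y (homogeneousComponent n u) = 0 := fun y hy =>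
    tendsto_nhds_unique (tendsto_hom hu y hy) (isLittleO_ray ho y hy)
  have h1 : X 0 * homogeneousComponent n u = 0 := by
    refine MvPolynomial.funext fun y => ?_
    by_cases hy : y = 0
    · subst hy; rw [map_mul, eval_X]; simp
    · rw [map_mul, h0 y hy]; simp
  have h2 : homogeneousComponent n u = 0 := by
    rcases mul_eq_zero.1 h1 with h | h
    · exact absurd h (X_ne_zero 0)
    · exact h
  have := sub_hom_mem hu
  rwa [h2, sub_zero] at this

theorem mem_of_isLittleO {m : ℕ} {u : MvPolynomial (Fin 2) ℝ}
    (ho : (fun y : Fin 2 → ℝ => eval y u) =o[𝓝[≠] 0] fun y => ‖y‖ ^ m) :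
    u ∈ 𝔪 ^ (m + 1) := by
  have : ∀ n, n ≤ m + 1 → u ∈ 𝔪 ^ n := by
    intro n
    induction n with
    | zero => simp
    | succ n ih =>
      intro hn
      refine step_mem (ih (by omega)) (ho.trans_isBigO ?_)
      refine IsBigO.of_bound 1 ?_
      have h1 : ∀ᶠ y : Fin 2 → ℝ in 𝓝[≠] 0, y ∈ Metric.ball (0 : Fin 2 → ℝ) 1 :=
        nhdsWithin_le_nhds (Metric.ball_mem_nhds _ one_pos)
      filter_upwards [h1] with y hy
      rw [mem_ball_zero_iff] at hy
      simp only [norm_pow, norm_norm, one_mul]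
      exact pow_le_pow_of_le_one (norm_nonneg _) hy.le (by omega)
  exact this _ le_rfl

theorem eval_shift (a y : Fin 2 → ℝ) (u : MvPolynomial (Fin 2) ℝ) :
    eval y (shiftPoly a u) = eval (a + y) u := by
  rw [shiftPoly, ← coe_aeval_eq_eval, ← coe_aeval_eq_eval, RingHom.coe_coe, RingHom.coe_coe,
    aeval_bind₁]
  congr 2
  ext i
  simp

theorem locPosDef_of_bound {D : MvPolynomial (Fin 2) ℝ} {a : Fin 2 → ℝ} {d : ℕ} {c : ℝ}
    (hc : 0 < c) (hD : shiftPoly a D ∈ 𝔪 ^ d)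
    (hb : ∀ᶠ y : Fin 2 → ℝ in 𝓝 0, c * ‖y‖ ^ d ≤ eval y (shiftPoly a D)) : LocPosDef D a := by
  have hpos : ∀ y : Fin 2 → ℝ, y ≠ 0 →
      0 < eval y (homogeneousComponent d (shiftPoly a D)) := by
    intro y hy
    have hy' : 0 < ‖y‖ := norm_pos_iff.2 hy
    refine (show 0 < c * ‖y‖ ^ d by positivity).trans_le ?_
    refine ge_of_tendsto (tendsto_hom hD y hy) ?_
    filter_upwards [self_mem_nhdsWithin,
      (tendsto_ray y hy).eventually (nhdsWithin_le_nhds hb)] with t ht h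
    have ht' : (0 : ℝ) < t := ht
    rw [le_div_iff₀ (by positivity)]
    refine le_trans (le_of_eq ?_) h
    rw [norm_smul, Real.norm_eq_abs, abs_of_pos ht']
    ring
  refine ⟨d, ?_, (mem_pow_iff_hom _ _).1 hD, hpos⟩
  intro h
  have := hpos (fun _ => 1) (by intro h; simpa using congrFun h 0)
  rw [h] at this
  simp at this

theorem bound_of_locPosDef {D : MvPolynomial (Fin 2) ℝ} {a : Fin 2 → ℝ} (h : LocPosDef D a) :
    ∃ m : ℕ, ∃ c : ℝ, 0 < c ∧ shiftPoly a D ∈ 𝔪 ^ m ∧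
      ∀ᶠ y : Fin 2 → ℝ in 𝓝 0, c * ‖y‖ ^ m ≤ eval y (shiftPoly a D) := by
  obtain ⟨m, -, h1, h2⟩ := h
  have hm := (mem_pow_iff_hom _ _).2 h1
  set H := homogeneousComponent m (shiftPoly a D) with hH
  have hne : (Metric.sphere (0 : Fin 2 → ℝ) 1).Nonempty := NormedSpace.sphere_nonempty.2 zero_le_one
  obtain ⟨z, hz, hmin⟩ := (isCompact_sphere (0 : Fin 2 → ℝ) 1).exists_isMinOn hne
    (continuous_eval H).continuousOn
  have hz0 : z ≠ 0 := by
    rintro rfl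
    simp at hz
  have hc := h2 z hz0
  have hlow : ∀ y : Fin 2 → ℝ, eval z H * ‖y‖ ^ m ≤ eval y H ∨ y = 0 := by
    intro y
    by_cases hy : y = 0
    · exact Or.inr hy
    · left
      have hy' : 0 < ‖y‖ := norm_pos_iff.2 hy
      have h3 : eval z H ≤ eval (‖y‖⁻¹ • y) H := by
        apply hmin
        simp [norm_smul, hy'.ne']
      have h4 : eval y H = ‖y‖ ^ m * eval (‖y‖⁻¹ • y) H := by
        rw [hH, ← hom_eval_smul, smul_smul, mul_inv_cancel₀ hy'.ne', one_smul]
      rw [h4, mul_comm]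
      gcongr
  have hlow' : ∀ y : Fin 2 → ℝ, eval z H * ‖y‖ ^ m ≤ eval y H := by
    have hcl : IsClosed {y : Fin 2 → ℝ | eval z H * ‖y‖ ^ m ≤ eval y H} :=
      isClosed_le (by fun_prop) (continuous_eval H)
    have hd : Dense ({0}ᶜ : Set (Fin 2 → ℝ)) := dense_compl_singleton 0
    intro y
    have : closure ({0}ᶜ : Set (Fin 2 → ℝ)) ⊆ {y : Fin 2 → ℝ | eval z H * ‖y‖ ^ m ≤ eval y H} :=
      hcl.closure_subset_iff.2 fun y hy => (hlow y).resolve_right hy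
    exact this (hd y)
  refine ⟨m, eval z H / 2, by positivity, hm, ?_⟩
  filter_upwards [(rem_isLittleO (sub_hom_mem hm)).def (half_pos hc)] with y hy
  rw [map_sub, norm_pow, norm_norm, Real.norm_eq_abs, ← hH] at hy
  have := neg_le_of_abs_le hy
  have := hlow' y
  linarith

theorem contDiffAt_quot {k d : ℕ} {u D : MvPolynomial (Fin 2) ℝ} {a : Fin 2 → ℝ} {c : ℝ}
    (hc : 0 < c) (hu : shiftPoly a u ∈ 𝔪 ^ (d + k + 1)) (hD : shiftPoly a D ∈ 𝔪 ^ d)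
    (hb : ∀ᶠ y : Fin 2 → ℝ in 𝓝 0, c * ‖y‖ ^ d ≤ eval y (shiftPoly a D)) :
    ContDiffAt ℝ k (fun x => eval x u / eval x D) a := by
  obtain ⟨U, hU, hUo, h0⟩ := eventually_nhds_iff.1 hb
  have h := quot_contDiffOn k hUo h0 hc hu hD fun y hy => (hU y hy).trans (le_abs_self _)
  have h1 := h.contDiffAt (hUo.mem_nhds h0)
  have h2 : ContDiffAt ℝ k (fun x : Fin 2 → ℝ => x - a) a := by fun_prop
  have h3 : ContDiffAt ℝ k (fun y : Fin 2 → ℝ => eval y (shiftPoly a u) / eval y (shiftPoly a D))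
    (a - a) := by rwa [sub_self]
  have := ContDiffAt.comp (f := fun x : Fin 2 → ℝ => x - a) a h3 h2
  simpa [Function.comp_def, eval_shift] using this

theorem shift_add (a : Fin 2 → ℝ) (u v : MvPolynomial (Fin 2) ℝ) :
    shiftPoly a (u + v) = shiftPoly a u + shiftPoly a v := map_add _ _ _

theorem shift_pow (a : Fin 2 → ℝ) (u : MvPolynomial (Fin 2) ℝ) (n : ℕ) :
    shiftPoly a (u ^ n) = shiftPoly a u ^ n := map_pow _ _ _

/-- The order of vanishing forced by continuity of `f = p / q`. -/
theorem diff_mem {f : (Fin 2 → ℝ) → ℝ} (hf : Continuous f) {p q : MvPolynomial (Fin 2) ℝ}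
    (hfpq : ∀ x : Fin 2 → ℝ, eval x q ≠ 0 → f x = eval x p / eval x q)
    {a : Fin 2 → ℝ} {m : ℕ} {c : ℝ} (hc : 0 < c) (hq : shiftPoly a q ∈ 𝔪 ^ m)
    (hb : ∀ᶠ y : Fin 2 → ℝ in 𝓝 0, c * ‖y‖ ^ m ≤ eval y (shiftPoly a q)) :
    shiftPoly a p - C (f a) * shiftPoly a q ∈ 𝔪 ^ (m + 1) := by
  apply mem_of_isLittleO
  have h1 : (fun y : Fin 2 → ℝ => f (a + y) - f a) =o[𝓝 0] fun _ => (1 : ℝ) := by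
    rw [isLittleO_one_iff]
    have : Continuous fun y : Fin 2 → ℝ => f (a + y) - f a := by fun_prop
    simpa using this.tendsto 0
  have h2 := (h1.mul_isBigO (ev_isBigO m _ hq)).mono (nhdsWithin_le_nhds (s := {0}ᶜ))
  simp only [one_mul] at h2
  refine h2.congr' ?_ EventuallyEq.rfl
  filter_upwards [self_mem_nhdsWithin, nhdsWithin_le_nhds hb] with y hy hy2
  have hy' : 0 < ‖y‖ := norm_pos_iff.2 hy
  have h3 : eval y (shiftPoly a q) ≠ 0 := by
    have : 0 < c * ‖y‖ ^ m := by positivity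
    linarith
  rw [eval_shift] at h3
  rw [map_sub, map_mul, eval_C, eval_shift, eval_shift, hfpq _ h3]
  field_simp

theorem isRelPrime_aux {p q : MvPolynomial (Fin 2) ℝ} (h : IsRelPrime p q) {α β : ℕ} :
    IsRelPrime (p ^ α) (p ^ α + q ^ β) := by
  have h1 : IsRelPrime (p ^ α) (q ^ β) := IsRelPrime.pow h
  intro d hd1 hd2
  exact h1 hd1 ((dvd_add_right hd1).1 hd2)

theorem ne_of_bound {D : MvPolynomial (Fin 2) ℝ} {a : Fin 2 → ℝ} {d : ℕ} {c : ℝ}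
    (hc : 0 < c)
    (hb : ∀ᶠ y : Fin 2 → ℝ in 𝓝 0, c * ‖y‖ ^ d ≤ eval y (shiftPoly a D)) :
    ∀ᶠ x in 𝓝 a, x ≠ a → eval x D ≠ 0 := by
  have h2 : Tendsto (fun x : Fin 2 → ℝ => x - a) (𝓝 a) (𝓝 0) := by
    have : Continuous fun x : Fin 2 → ℝ => x - a := by fun_prop
    simpa using this.tendsto a
  filter_upwards [h2.eventually hb] with x hx hne
  have hy' : 0 < ‖x - a‖ := norm_pos_iff.2 (sub_ne_zero.2 hne)
  have : 0 < c * ‖x - a‖ ^ d := by positivity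
  rw [eval_shift, add_sub_cancel] at hx
  linarith

/-- Local analysis at a point with `f a = 0`. -/
theorem local_zero {p q : MvPolynomial (Fin 2) ℝ} {a : Fin 2 → ℝ} {m k α β : ℕ} {c : ℝ}
    (hc : 0 < c) (hq : shiftPoly a q ∈ 𝔪 ^ m)
    (hb : ∀ᶠ y : Fin 2 → ℝ in 𝓝 0, c * ‖y‖ ^ m ≤ eval y (shiftPoly a q))
    (hp : shiftPoly a p ∈ 𝔪 ^ (m + 1)) (hα : Even α) (hαβ : m * β + k + 1 ≤ (m + 1) * α) :
    shiftPoly a (p ^ α) ∈ 𝔪 ^ (m * β + k + 1) ∧ shiftPoly a (p ^ α + q ^ β) ∈ 𝔪 ^ (m * β) ∧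
    ∀ᶠ y : Fin 2 → ℝ in 𝓝 0, c ^ β * ‖y‖ ^ (m * β) ≤ eval y (shiftPoly a (p ^ α + q ^ β)) := by
  have h1 : shiftPoly a (p ^ α) ∈ 𝔪 ^ (m * β + k + 1) := by
    refine Ideal.pow_le_pow_right hαβ ?_
    rw [shift_pow, pow_mul]
    exact Ideal.pow_mem_pow hp _
  refine ⟨h1, ?_, ?_⟩
  · rw [shift_add]
    refine Ideal.add_mem _ (Ideal.pow_le_pow_right (by omega) h1) ?_
    rw [shift_pow, pow_mul]
    exact Ideal.pow_mem_pow hq _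
  · filter_upwards [hb] with y hy
    rw [shift_add, shift_pow, shift_pow, map_add, map_pow, map_pow]
    have h2 : (c * ‖y‖ ^ m) ^ β ≤ eval y (shiftPoly a q) ^ β := by gcongr
    have h3 := hα.pow_nonneg (eval y (shiftPoly a p))
    rw [mul_pow, ← pow_mul] at h2
    linarith

/-- Local analysis at a point with `f a = e ≠ 0`. -/
theorem local_nonzero {p q : MvPolynomial (Fin 2) ℝ} {a : Fin 2 → ℝ} {m k α β : ℕ} {c e : ℝ}
    (hc : 0 < c) (he : e ≠ 0) (hq : shiftPoly a q ∈ 𝔪 ^ m)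
    (hb : ∀ᶠ y : Fin 2 → ℝ in 𝓝 0, c * ‖y‖ ^ m ≤ eval y (shiftPoly a q))
    (hp : shiftPoly a p - C e * shiftPoly a q ∈ 𝔪 ^ (m + 1)) (hα : Even α) (hβ : Even β)
    (hαβ : m * α + k + 1 ≤ m * β) :
    shiftPoly a (q ^ β) ∈ 𝔪 ^ (m * α + k + 1) ∧ shiftPoly a (p ^ α + q ^ β) ∈ 𝔪 ^ (m * α) ∧
    ∃ c' : ℝ, 0 < c' ∧
    ∀ᶠ y : Fin 2 → ℝ in 𝓝 0, c' * ‖y‖ ^ (m * α) ≤ eval y (shiftPoly a (p ^ α + q ^ β)) := by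
  have he' : 0 < |e| := abs_pos.2 he
  have h1 : shiftPoly a (q ^ β) ∈ 𝔪 ^ (m * α + k + 1) := by
    refine Ideal.pow_le_pow_right hαβ ?_
    rw [shift_pow, pow_mul]
    exact Ideal.pow_mem_pow hq _
  have hpm : shiftPoly a p ∈ 𝔪 ^ m := by
    have := Ideal.add_mem _ (Ideal.pow_le_pow_right (Nat.le_succ m) hp)
      (Ideal.mul_mem_left _ (C e) hq)
    simpa using this
  have hpos : 0 < |e| * c / 2 := by positivity
  refine ⟨h1, ?_, (|e| * c / 2) ^ α, by positivity, ?_⟩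
  · rw [shift_add]
    refine Ideal.add_mem _ ?_ (Ideal.pow_le_pow_right (by omega) h1)
    rw [shift_pow, pow_mul]
    exact Ideal.pow_mem_pow hpm _
  · filter_upwards [hb, (rem_isLittleO hp).def hpos] with y hy hy2
    rw [shift_add, shift_pow, shift_pow, map_add, map_pow, map_pow]
    rw [map_sub, map_mul, eval_C, norm_pow, norm_norm, Real.norm_eq_abs] at hy2
    set P := eval y (shiftPoly a p)
    set Q := eval y (shiftPoly a q)
    have h4 : |e| * c / 2 * ‖y‖ ^ m ≤ |P| := by
      have h5 : |e * Q| ≤ |P| + |P - e * Q| := by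
        have := abs_sub P (P - e * Q)
        simpa using this
      have h6 : |e| * (c * ‖y‖ ^ m) ≤ |e * Q| := by
        rw [abs_mul]
        exact mul_le_mul_of_nonneg_left (hy.trans (le_abs_self _)) he'.le
      linarith
    have h2 : (|e| * c / 2 * ‖y‖ ^ m) ^ α ≤ |P| ^ α := by gcongr
    have h3 := hβ.pow_nonneg Q
    rw [mul_pow, ← pow_mul, hα.pow_abs] at h2
    linarith

/-- for every `k` and every [1]-regulous `f`, there is a `C^k` [1]-regulous
function with the same zero set. -/
theorem zero_set_of_oneRegulous_is_zero_set_of_Ck_oneRegulous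
    (k : ℕ) (f : (Fin 2 → ℝ) → ℝ) (hf : OneRegulous f) :
    ∃ g : (Fin 2 → ℝ) → ℝ, OneRegulous g ∧ ContDiff ℝ k g ∧
      {x | g x = 0} = {x | f x = 0} := by
  classical
  obtain ⟨hcont, p, q, hrel, hq0, hfin, hfpq, hloc⟩ := hf
  -- orders at the zeros of `q`
  have hex : ∀ a : Fin 2 → ℝ, ∃ m : ℕ, eval a q = 0 → ∃ c : ℝ, 0 < c ∧ 1 ≤ m ∧
      shiftPoly a q ∈ 𝔪 ^ m ∧
      (∀ᶠ y : Fin 2 → ℝ in 𝓝 0, c * ‖y‖ ^ m ≤ eval y (shiftPoly a q)) := by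
    intro a
    by_cases ha : eval a q = 0
    · obtain ⟨m, c, hc, h1, h2⟩ := bound_of_locPosDef (hloc a ha)
      refine ⟨m, fun _ => ⟨c, hc, ?_, h1, h2⟩⟩
      by_contra hm
      have hm0 : m = 0 := by omega
      subst hm0
      have := h2.self_of_nhds
      rw [eval_shift, add_zero, ha] at this
      simp at this
      linarith
    · exact ⟨0, fun h => absurd h ha⟩
  choose m hm using hex
  obtain ⟨M, hM⟩ : ∃ M, ∀ a, eval a q = 0 → m a ≤ M := by
    obtain ⟨M, hM⟩ := (hfin.image m).bddAbove
    exact ⟨M, fun a ha => hM ⟨a, ha, rfl⟩⟩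
  set s := 2 * (k + 1) with hs
  set α := 2 * (s * M + k + 1) with hα
  set β := α + s with hβ
  have hαe : Even α := ⟨s * M + k + 1, by omega⟩
  have hβe : Even β := hαe.add ⟨k + 1, by omega⟩
  have hα0 : α ≠ 0 := by omega
  have hβ0 : β ≠ 0 := by omega
  set D := p ^ α + q ^ β with hD
  have hDev : ∀ x, eval x D = eval x p ^ α + eval x q ^ β := by intro x; simp [hD]
  have hDnn : ∀ x, 0 ≤ eval x D := fun x => by
    rw [hDev]; exact add_nonneg (hαe.pow_nonneg _) (hβe.pow_nonneg _)
  have hDz : ∀ x, eval x D = 0 → eval x p = 0 ∧ eval x q = 0 := by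
    intro x hx
    rw [hDev] at hx
    have h1 := hαe.pow_nonneg (eval x p)
    have h2 := hβe.pow_nonneg (eval x q)
    exact ⟨(pow_eq_zero_iff hα0).1 (by linarith), (pow_eq_zero_iff hβ0).1 (by linarith)⟩
  -- inequalities on the exponents
  have ineq0 : ∀ a, eval a q = 0 → m a * β + k + 1 ≤ (m a + 1) * α := by
    intro a ha
    have h1 : s * m a ≤ s * M := Nat.mul_le_mul_left _ (hM a ha)
    have h2 : m a * β = m a * α + s * m a := by rw [hβ]; ring
    have h3 : (m a + 1) * α = m a * α + α := by ring
    omega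
  have ineq1 : ∀ a, 1 ≤ m a → m a * α + k + 1 ≤ m a * β := by
    intro a ha
    have h2 : m a * β = m a * α + s * m a := by rw [hβ]; ring
    have h3 : s * 1 ≤ s * m a := Nat.mul_le_mul_left _ ha
    omega
  set g : (Fin 2 → ℝ) → ℝ := fun x =>
    if eval x D = 0 ∧ f x ≠ 0 then 1 else eval x (p ^ α) / eval x D with hg
  have hgne : ∀ x, eval x D ≠ 0 → g x = eval x (p ^ α) / eval x D := by
    intro x hx
    simp [hg, hx]
  -- local analysis at the zeros of `D`
  have hlocal : ∀ a, eval a D = 0 → LocPosDef D a ∧ ContDiffAt ℝ k g a := by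
    intro a ha
    obtain ⟨hpa, hqa⟩ := hDz a ha
    obtain ⟨c, hc, hm1, hqm, hb⟩ := hm a hqa
    have hdiff := diff_mem hcont hfpq hc hqm hb
    by_cases hfa : f a = 0
    · rw [hfa, C_0, zero_mul, sub_zero] at hdiff
      obtain ⟨h1, h2, h3⟩ := local_zero (k := k) hc hqm hb hdiff hαe (ineq0 a hqa)
      have hcβ : 0 < c ^ β := by positivity
      refine ⟨locPosDef_of_bound hcβ h2 h3, ?_⟩
      refine (contDiffAt_quot hcβ h1 h2 h3).congr_of_eventuallyEq ?_
      filter_upwards [ne_of_bound hcβ h3] with x hx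
      by_cases hxa : x = a
      · subst hxa
        simp only [hg]
        rw [if_neg (by simp [hfa])]
      · exact hgne x (hx hxa)
    · obtain ⟨h1, h2, c', hc', h3⟩ := local_nonzero (k := k) hc hfa hqm hb hdiff hαe hβe
        (ineq1 a hm1)
      refine ⟨locPosDef_of_bound hc' h2 h3, ?_⟩
      have h4 : ContDiffAt ℝ k (fun x => 1 - eval x (q ^ β) / eval x D) a :=
        contDiffAt_const.sub (contDiffAt_quot hc' h1 h2 h3)
      refine h4.congr_of_eventuallyEq ?_
      filter_upwards [ne_of_bound hc' h3] with x hx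
      by_cases hxa : x = a
      · subst hxa
        simp only [hg]
        rw [if_pos ⟨ha, hfa⟩, ha]
        simp
      · have h5 := hx hxa
        rw [hgne x h5, eq_sub_iff_add_eq, ← add_div, ← map_add]
        exact div_self h5
  have hCk : ContDiff ℝ k g := by
    rw [contDiff_iff_contDiffAt]
    intro x
    by_cases hx : eval x D = 0
    · exact (hlocal x hx).2
    · refine ((contDiff_ev (p ^ α) k).contDiffAt.div (contDiff_ev D k).contDiffAt
        hx).congr_of_eventuallyEq ?_
      filter_upwards [(continuous_eval D).continuousAt.eventually_ne hx] with y hy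
      exact hgne y hy
  refine ⟨g, ⟨hCk.continuous, p ^ α, D, isRelPrime_aux hrel, hDnn, ?_, hgne,
    fun a ha => (hlocal a ha).1⟩, hCk, ?_⟩
  · exact hfin.subset fun x hx => (hDz x hx).2
  · ext x
    simp only [Set.mem_ofPred_eq]
    by_cases hx : eval x D = 0
    · by_cases hfx : f x = 0
      · simp [hg, hx, hfx]
      · simp [hg, hx, hfx]
    · rw [hgne x hx, div_eq_zero_iff, or_iff_left hx, map_pow, pow_eq_zero_iff hα0]
      by_cases hqx : eval x q = 0
      · -- continuity forces `p x = 0` as well, so `D x = 0`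
        exfalso
        obtain ⟨c, hc, hm1, hqm, hb⟩ := hm x hqx
        have hdiff := diff_mem hcont hfpq hc hqm hb
        have h1 := (ev_isBigO _ _ hdiff).eq_zero_imp.self_of_nhds (by simp)
        rw [map_sub, map_mul, eval_shift, eval_shift, add_zero, hqx, mul_zero, sub_zero] at h1
        apply hx
        rw [hDev, h1, hqx, zero_pow hα0, zero_pow hβ0, add_zero]
      · rw [hfpq x hqx, div_eq_zero_iff, or_iff_left hqx]
end
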